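/- arXiv:1810.08240 — 7 statements merged into one kernel-verified Lean document; each statement's English description precedes it below -/
import Mathlib

section
/- Stitched boundary theorem (upper crossing probability): For any c ≥ 0, α ∈ (0,1), η > 1, m > 0, l0 ≥ 1, and any increasing function h : ℝ≥0 → ℝ>0 with Σ_{k=0}^∞ 1/h(k) ≤ 1, the function v ↦ S_α(max(v, m)) is an l0-sub-ψ_{G,c} uniform boundary with crossing probability α; that is, for every l0-sub-ψ_{G,c} process (S_t) with variance process (V_t), P(∃ t ≥ 1 : S_t ≥ S_α(max(V_t, m))) ≤ α. -/
open MeasureTheory ProbabilityTheory Filter Set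

noncomputable section

/-- `S` is an `l0`-sub-ψ process with variance process `V`, where ψ has domain `D`:
for each `λ ∈ D` there is a nonnegative supermartingale `L(λ)` with `E L_0(λ) ≤ l0`
dominating `exp(λ S_t − ψ(λ) V_t)`. -/
def IsSubPsi {Ω : Type*} {mΩ : MeasurableSpace Ω} (P : Measure Ω)
    (F : Filtration ℕ mΩ) (D : Set ℝ) (ψ : ℝ → ℝ) (l0 : ℝ)
    (S V : ℕ → Ω → ℝ) : Prop :=
  Adapted F S ∧ Adapted F V ∧
    (∀ ω, S 0 ω = 0) ∧ (∀ ω, V 0 ω = 0) ∧ (∀ t ω, 0 ≤ V t ω) ∧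
    ∀ l ∈ D, ∃ L : ℕ → Ω → ℝ,
      Supermartingale L F P ∧ (∀ t ω, 0 ≤ L t ω) ∧
      (∫ ω, L 0 ω ∂P) ≤ l0 ∧
      ∀ t : ℕ, ∀ᵐ ω ∂P, Real.exp (l * S t ω - ψ l * V t ω) ≤ L t ω

/-- `u` is an `l0`-sub-ψ uniform boundary with crossing probability `α`. -/
def IsUniformBoundary (D : Set ℝ) (ψ : ℝ → ℝ) (l0 α : ℝ) (u : ℝ → ℝ) : Prop :=
  ∀ (Ω : Type) (mΩ : MeasurableSpace Ω) (P : Measure Ω),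
    IsProbabilityMeasure P →
    ∀ (F : Filtration ℕ mΩ) (S V : ℕ → Ω → ℝ),
      IsSubPsi P F D ψ l0 S V →
      P {ω | ∃ t : ℕ, 1 ≤ t ∧ u (V t ω) ≤ S t ω} ≤ ENNReal.ofReal α

/-- ψ_{G,c}, the sub-gamma `ψ` function. -/
def psiG (c l : ℝ) : ℝ := l ^ 2 / (2 * (1 - c * l))

/-- Domain `[0, 1/(c ⊔ 0))` of ψ_{G,c} (with `1/0 = ∞`). -/
def psiGDom (c : ℝ) : Set ℝ := {l : ℝ | 0 ≤ l ∧ (0 < c → l < 1 / c)}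

/-- ℓ(v) = log h(log_η(v/m)) + log(l0/α). -/
def stitchEll (h : ℝ → ℝ) (η m l0 α v : ℝ) : ℝ :=
  Real.log (h (Real.logb η (v / m))) + Real.log (l0 / α)

def stitchK1 (η : ℝ) : ℝ := (η ^ ((1 : ℝ) / 4) + η ^ (-(1 : ℝ) / 4)) / Real.sqrt 2

def stitchK2 (η : ℝ) : ℝ := (Real.sqrt η + 1) / 2

/-- The stitching function 𝒮_α(v). -/
def stitchFn (h : ℝ → ℝ) (η m l0 α c v : ℝ) : ℝ :=
  Real.sqrt (stitchK1 η ^ 2 * v * stitchEll h η m l0 α v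
      + stitchK2 η ^ 2 * c ^ 2 * stitchEll h η m l0 α v ^ 2)
    + c * stitchK2 η * stitchEll h η m l0 α v

/-- **Ville's inequality**: a nonnegative supermartingale ever reaches the level `a` with
probability at most `𝔼[L 0] / a`. -/
lemma measure_exists_ge_le_of_supermartingale {Ω : Type*} {mΩ : MeasurableSpace Ω} {P : Measure Ω}
    [IsFiniteMeasure P] {F : Filtration ℕ mΩ} {L : ℕ → Ω → ℝ} (hL : Supermartingale L F P)
    (hnonneg : ∀ t ω, 0 ≤ L t ω) {a : ℝ} (ha : 0 < a) :
    P {ω | ∃ t, a ≤ L t ω} ≤ ENNReal.ofReal ((∫ ω, L 0 ω ∂P) / a) := by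
  have hunion : {ω | ∃ t, a ≤ L t ω} = ⋃ n : ℕ, {ω | ∃ t ≤ n, a ≤ L t ω} := by
    ext ω
    simp only [mem_iUnion, mem_ofPred_eq]
    exact ⟨fun ⟨t, ht⟩ => ⟨t, t, le_rfl, ht⟩, fun ⟨_, t, _, ht⟩ => ⟨t, ht⟩⟩
  have hmono : Monotone fun n : ℕ => {ω | ∃ t ≤ n, a ≤ L t ω} :=
    fun _ _ hij _ ⟨t, ht, hat⟩ => ⟨t, ht.trans hij, hat⟩
  rw [hunion, hmono.measure_iUnion]
  refine iSup_le fun n => ?_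
  set τ : Ω → ℕ∞ := fun ω => (hittingBtwn L (Ici a) 0 n ω : ℕ)
  have hτ : IsStoppingTime F τ :=
    hL.stronglyAdapted.adapted.isStoppingTime_hittingBtwn measurableSet_Ici
  have hτn : ∀ ω, τ ω ≤ n := fun ω => Nat.cast_le.2 (hittingBtwn_le ω)
  have hint : Integrable (stoppedValue L τ) P := by
    refine (hL.neg.integrable_stoppedValue hτ hτn).neg.congr (ae_of_all P fun ω => ?_)
    simp [stoppedValue]
  have hle : ∫ ω, stoppedValue L τ ω ∂P ≤ ∫ ω, L 0 ω ∂P := by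
    have hmean := hL.neg.expected_stoppedValue_mono (isStoppingTime_const F 0) hτ
      (fun ω => zero_le) hτn
    simp only [stoppedValue, Pi.neg_apply, integral_neg, neg_le_neg_iff] at hmean
    exact hmean
  have hmarkov := mul_meas_ge_le_integral_of_nonneg (f := stoppedValue L τ)
    (ae_of_all P fun ω => hnonneg (τ ω).untopA ω) hint a
  have hsub : {ω | ∃ t ≤ n, a ≤ L t ω} ⊆ {ω | a ≤ stoppedValue L τ ω} := by
    rintro ω ⟨t, ht, hat⟩
    exact hittingBtwn_mem_set (u := L) (s := Ici a) ⟨t, ⟨Nat.zero_le _, ht⟩, hat⟩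
  refine (measure_mono hsub).trans ?_
  rw [← ofReal_measureReal]
  refine ENNReal.ofReal_le_ofReal ((le_div_iff₀ ha).2 ?_)
  linarith

lemma IsSubPsi.measure_line_crossing_le {Ω : Type*} {mΩ : MeasurableSpace Ω} {P : Measure Ω}
    [IsFiniteMeasure P] {F : Filtration ℕ mΩ} {D : Set ℝ} {ψ : ℝ → ℝ} {l0 : ℝ} {S V : ℕ → Ω → ℝ}
    (hSV : IsSubPsi P F D ψ l0 S V) {l : ℝ} (hl : l ∈ D) (r : ℝ) :
    P {ω | ∃ t, r + ψ l * V t ω ≤ l * S t ω} ≤ ENNReal.ofReal (l0 * Real.exp (-r)) := by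
  obtain ⟨-, -, -, -, -, hex⟩ := hSV
  obtain ⟨L, hL, hnonneg, hL0, hdom⟩ := hex l hl
  have hae : {ω | ∃ t, r + ψ l * V t ω ≤ l * S t ω} ≤ᵐ[P] {ω | ∃ t, Real.exp r ≤ L t ω} := by
    filter_upwards [ae_all_iff.2 hdom] with ω hω
    rintro ⟨t, ht⟩
    exact ⟨t, (Real.exp_le_exp.2 (by linarith)).trans (hω t)⟩
  refine (measure_mono_ae hae).trans
    ((measure_exists_ge_le_of_supermartingale hL hnonneg (Real.exp_pos r)).trans ?_)
  rw [Real.exp_neg, ← div_eq_mul_inv]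
  gcongr

/-- On `[w / p, p * w]`, the function `v ↦ √(k₁² v r + k₂² c² r²) + c k₂ r` dominates the line of
slope `ψ(l) / l` and intercept `r / l`, where `ψ(l) = r / w`. -/
lemma exists_psiG_line_le {c r p w : ℝ} (hc : 0 ≤ c) (hr : 0 < r) (hp : 0 < p) (hw : 0 < w) :
    ∃ l ∈ psiGDom c, 0 < l ∧ 0 ≤ psiG c l ∧ ∀ v, w ≤ p * v → v ≤ p * w →
      r + psiG c l * v ≤ l * (Real.sqrt ((p + p⁻¹ + 2) / 2 * v * r
        + ((p + 1) / 2) ^ 2 * c ^ 2 * r ^ 2) + c * ((p + 1) / 2) * r) := by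
  set q := Real.sqrt (c ^ 2 + 2 * w / r)
  have hwr : 0 < 2 * w / r := by positivity
  have hq2 : q ^ 2 = c ^ 2 + 2 * w / r := Real.sq_sqrt (by positivity)
  have hq0 : 0 ≤ q := Real.sqrt_nonneg _
  have hcq : c < q := lt_of_pow_lt_pow_left₀ 2 hq0 (by linarith)
  have hcq' : 0 < c + q := by linarith
  have hqc : 0 < q - c := by linarith
  have hψ : psiG c (2 / (c + q)) = r / w := by
    have h1 : 1 - c * (2 / (c + q)) = (q - c) / (c + q) := by field_simp; ring
    have h2 : r * ((q - c) * (c + q)) = 2 * w := by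
      have : r * (2 * w / r) = 2 * w := by field_simp
      linear_combination r * hq2 + this
    rw [psiG, h1]
    field_simp
    linear_combination -h2
  refine ⟨2 / (c + q), ⟨by positivity, fun hc0 => ?_⟩, by positivity, by rw [hψ]; positivity,
    fun v hv1 hv2 => ?_⟩
  · rw [div_lt_div_iff₀ hcq' hc0]
    linarith
  · rw [hψ, div_mul_eq_mul_div 2, le_div_iff₀ hcq']
    obtain ⟨s, rfl⟩ : ∃ s, v = s * w := ⟨v / w, by field_simp⟩
    have hs1 : 1 ≤ p * s := by
      refine le_of_mul_le_mul_right ?_ hw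
      linarith
    have hs2 : s ≤ p := le_of_mul_le_mul_right hv2 hw
    have hs0 : 0 < s := pos_of_mul_pos_right (by linarith) hp.le
    have hkey : (1 + s) ^ 2 ≤ s * (p + p⁻¹ + 2) := by
      have : s * (p + p⁻¹ + 2) - (1 + s) ^ 2 = (p - s) * (p * s - 1) / p := by
        field_simp; ring
      have : 0 ≤ (p - s) * (p * s - 1) / p :=
        div_nonneg (mul_nonneg (by linarith) (by linarith)) hp.le
      linarith
    have hsqrt : r * (1 + s) * q / 2 ≤ Real.sqrt ((p + p⁻¹ + 2) / 2 * (s * w) * r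
        + ((p + 1) / 2) ^ 2 * c ^ 2 * r ^ 2) := by
      apply Real.le_sqrt_of_sq_le
      have heq : (r * (1 + s) * q / 2) ^ 2
          = (1 + s) ^ 2 * (w * r) / 2 + (1 + s) ^ 2 * (c * r) ^ 2 / 4 := by
        have : r * (2 * w / r) = 2 * w := by field_simp
        linear_combination r ^ 2 * (1 + s) ^ 2 / 4 * hq2 + r * (1 + s) ^ 2 / 4 * this
      have hfst := mul_le_mul_of_nonneg_right hkey (mul_pos hw hr).le
      have hsnd : (1 + s) ^ 2 * (c * r) ^ 2 ≤ (p + 1) ^ 2 * (c * r) ^ 2 := by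
        gcongr ?_ ^ 2 * _
        linarith
      rw [heq]
      linarith
    have hlin : r * (1 + s) * c / 2 ≤ c * ((p + 1) / 2) * r := by
      have := mul_le_mul_of_nonneg_right hs2 (mul_nonneg hc hr.le)
      linarith
    have hcancel : r / w * (s * w) = r * s := by field_simp
    rw [hcancel]
    linarith

lemma stitchK1_sq {η : ℝ} (hη : 0 < η) :
    stitchK1 η ^ 2 = (Real.sqrt η + (Real.sqrt η)⁻¹ + 2) / 2 := by
  have hx : (η ^ ((1 : ℝ) / 4)) ^ 2 = Real.sqrt η := by
    rw [Real.sqrt_eq_rpow, ← Real.rpow_natCast, ← Real.rpow_mul hη.le]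
    norm_num
  have hx0 : 0 < η ^ ((1 : ℝ) / 4) := Real.rpow_pos_of_pos hη _
  rw [stitchK1, div_pow, Real.sq_sqrt (by norm_num), neg_div, Real.rpow_neg hη.le, ← hx]
  field_simp
  ring

lemma exists_nat_geometric_epoch {η m v : ℝ} (hη : 1 < η) (hm : 0 < m) (hv : m ≤ v) :
    ∃ k : ℕ, (k : ℝ) ≤ Real.logb η (v / m) ∧ m * η ^ k ≤ v ∧ v ≤ m * η ^ (k + 1) := by
  have hη0 : 0 < η := by linarith
  have hvm : 0 < v / m := div_pos (hm.trans_le hv) hm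
  have hx : 0 ≤ Real.logb η (v / m) := Real.logb_nonneg hη ((one_le_div hm).2 hv)
  refine ⟨⌊Real.logb η (v / m)⌋₊, Nat.floor_le hx, ?_, ?_⟩
  · have := (Real.le_logb_iff_rpow_le hη hvm).1 (Nat.floor_le hx)
    rw [Real.rpow_natCast, le_div_iff₀ hm] at this
    linarith
  · have := (Real.logb_lt_iff_lt_rpow hη hvm).1 (Nat.lt_floor_add_one (Real.logb η (v / m)))
    rw [← Nat.cast_add_one, Real.rpow_natCast, div_lt_iff₀ hm] at this
    linarith

/-- Theorem 1 (stitched boundary): `v ↦ 𝒮_α(v ⊔ m)` is an `l0`-sub-ψ_{G,c} uniform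
boundary with crossing probability `α`. -/
theorem stitched_boundary
    (c α η m l0 : ℝ) (hc : 0 ≤ c) (hα : α ∈ Set.Ioo (0 : ℝ) 1) (hη : 1 < η)
    (hm : 0 < m) (hl0 : 1 ≤ l0)
    (h : ℝ → ℝ) (hpos : ∀ x : ℝ, 0 ≤ x → 0 < h x)
    (hmono : MonotoneOn h (Set.Ici 0))
    (hsummable : Summable fun k : ℕ => 1 / h k)
    (hsum : (∑' k : ℕ, 1 / h k) ≤ 1) :
    IsUniformBoundary (psiGDom c) (psiG c) l0 α
      (fun v => stitchFn h η m l0 α c (max v m)) := by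
  intro Ω mΩ P hP F S V hSV
  obtain ⟨hα0, hα1⟩ := hα
  have hη0 : 0 < η := by linarith
  have hl0' : 0 < l0 := by linarith
  set p := Real.sqrt η with hp_def
  have hp : 0 < p := Real.sqrt_pos.2 hη0
  have hpp : p * p = η := Real.mul_self_sqrt hη0.le
  have hpos' : ∀ k : ℕ, 0 < h k := fun k => hpos k k.cast_nonneg
  have hone : ∀ k : ℕ, 1 ≤ h k := fun k => by
    have := (hsummable.le_tsum k fun j _ => (one_div_pos.2 (hpos' j)).le).trans hsum
    rwa [div_le_one (hpos' k)] at this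
  have hlogα : 0 < Real.log (l0 / α) := Real.log_pos ((one_lt_div hα0).2 (by linarith))
  set r : ℕ → ℝ := fun k => Real.log (h k) + Real.log (l0 / α) with hr_def
  have hr : ∀ k, 0 < r k := fun k => add_pos_of_nonneg_of_pos (Real.log_nonneg (hone k)) hlogα
  have hexp : ∀ k, l0 * Real.exp (-r k) = α * (1 / h k) := fun k => by
    rw [Real.exp_neg, Real.exp_add, Real.exp_log (hpos' k), Real.exp_log (by positivity)]
    have := (hpos' k).ne'
    field_simp
  choose l hlD hl_pos hψ hline using fun k : ℕ =>
    exists_psiG_line_le (w := m * η ^ k * p) hc (hr k) hp (by positivity)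
  have hcover : {ω | ∃ t : ℕ, 1 ≤ t ∧ stitchFn h η m l0 α c (max (V t ω) m) ≤ S t ω}
      ⊆ ⋃ k, {ω | ∃ t, r k + psiG c (l k) * V t ω ≤ l k * S t ω} := by
    rintro ω ⟨t, -, ht⟩
    set v := max (V t ω) m
    have hv : 0 < v := hm.trans_le (le_max_right _ _)
    obtain ⟨k, hk, hk1, hk2⟩ := exists_nat_geometric_epoch hη hm (le_max_right (V t ω) m)
    refine mem_iUnion.2 ⟨k, t, ?_⟩
    have hell : r k ≤ stitchEll h η m l0 α v := by
      have := hmono (mem_Ici.2 k.cast_nonneg) (mem_Ici.2 <| k.cast_nonneg.trans hk) hk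
      have := Real.log_le_log (hpos' k) this
      simpa [hr_def, stitchEll] using this
    have hVv := mul_le_mul_of_nonneg_left (le_max_left (V t ω) m) (hψ k)
    have hstep := hline k v (by rw [mul_comm p]; gcongr) (by
      calc v ≤ m * η ^ (k + 1) := hk2
        _ = p * (m * η ^ k * p) := by rw [pow_succ, ← hpp]; ring)
    refine (add_le_add_right hVv _).trans (hstep.trans ?_)
    refine mul_le_mul_of_nonneg_left (le_trans ?_ ht) (hl_pos k).le
    have hrk := (hr k).le
    rw [stitchFn, stitchK1_sq hη0, stitchK2, ← hp_def]
    gcongr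
  calc P {ω | ∃ t : ℕ, 1 ≤ t ∧ stitchFn h η m l0 α c (max (V t ω) m) ≤ S t ω}
      ≤ ∑' k, P {ω | ∃ t, r k + psiG c (l k) * V t ω ≤ l k * S t ω} :=
        (measure_mono hcover).trans (measure_iUnion_le _)
    _ ≤ ∑' k : ℕ, ENNReal.ofReal (α * (1 / h k)) :=
        ENNReal.tsum_le_tsum fun k => by
          rw [← hexp k]
          exact hSV.measure_line_crossing_le (hlD k) (r k)
    _ = ENNReal.ofReal (α * ∑' k : ℕ, 1 / h k) := by
        rw [← tsum_mul_left, ENNReal.ofReal_tsum_of_nonneg _ (hsummable.mul_left α)]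
        exact fun k => mul_nonneg hα0.le (one_div_pos.2 (hpos' k)).le
    _ ≤ ENNReal.ofReal α :=
        ENNReal.ofReal_le_ofReal (mul_le_of_le_one_right hα0.le hsum)
end
end

section
/- Discrete mixture boundary: Fix ψ : [0, λ_max) → ℝ with ψ ≥ 0, α ∈ (0,1), λ̄ ∈ (0, λ_max), l0 ≥ 1, η > 1, and a probability density f on (0, λ̄] that is nonincreasing and positive. Define support points λ_k := λ̄ / η^{k+1/2} and weights w_k := λ̄ (η − 1) f(λ_k √η) / η^{k+1} for k = 0, 1, 2, …. Then the function DM_α(v) := sup{ s ∈ ℝ : Σ_{k=0}^∞ w_k exp(λ_k s − ψ(λ_k) v) < l0/α } is an l0-sub-ψ uniform boundary with crossing probability α; that is, for every l0-sub-ψ process (S_t) with variance process (V_t), P(∃ t ≥ 1 : S_t ≥ DM_α(V_t)) ≤ α. -/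
open MeasureTheory ProbabilityTheory Filter Set
open scoped ENNReal

noncomputable section

/-- `S` is an `l0`-sub-ψ process with variance process `V` on domain `D`, witnessed by a
family of nonnegative supermartingales `(L_t(λ))` that is jointly measurable in `(λ, ω)`. -/
def IsSubPsiMeas {Ω : Type*} {mΩ : MeasurableSpace Ω} (P : Measure Ω)
    (F : Filtration ℕ mΩ) (D : Set ℝ) (ψ : ℝ → ℝ) (l0 : ℝ)
    (S V : ℕ → Ω → ℝ) : Prop :=
  Adapted F S ∧ Adapted F V ∧
    (∀ ω, S 0 ω = 0) ∧ (∀ ω, V 0 ω = 0) ∧ (∀ t ω, 0 ≤ V t ω) ∧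
    ∃ L : ℝ → ℕ → Ω → ℝ,
      (∀ t : ℕ, Measurable (Function.uncurry fun l ω => L l t ω)) ∧
      ∀ l ∈ D, Supermartingale (L l) F P ∧ (∀ t ω, 0 ≤ L l t ω) ∧
        (∫ ω, L l 0 ω ∂P) ≤ l0 ∧
        ∀ t : ℕ, ∀ᵐ ω ∂P, Real.exp (l * S t ω - ψ l * V t ω) ≤ L l t ω

/-- Discrete mixture support points `λ_k = λ̄ / η^{k+1/2}`. -/
def dmLam (lam η : ℝ) (k : ℕ) : ℝ := lam / η ^ ((k : ℝ) + 1 / 2)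

/-- Discrete mixture weights `w_k = λ̄ (η − 1) f(λ_k √η) / η^{k+1}`. -/
def dmW (lam η : ℝ) (f : ℝ → ℝ) (k : ℕ) : ℝ :=
  lam * (η - 1) * f (dmLam lam η k * Real.sqrt η) / η ^ (k + 1)

/-- The discrete mixture boundary `DM_α`. -/
def dmBoundary (lam η : ℝ) (f ψ : ℝ → ℝ) (l0 α : ℝ) (v : ℝ) : ℝ :=
  sSup {s : ℝ |
    (∑' k : ℕ, dmW lam η f k * Real.exp (dmLam lam η k * s - ψ (dmLam lam η k) * v))
      < l0 / α}

/-- Ville's maximal inequality for an extended nonnegative supermartingale. -/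
theorem mul_measure_exists_ge_le_lintegral {Ω : Type*} {mΩ : MeasurableSpace Ω}
    (P : Measure Ω) (F : Filtration ℕ mΩ) (M : ℕ → Ω → ℝ≥0∞)
    (hM : ∀ n, Measurable[F n] (M n))
    (hsuper : ∀ n A, MeasurableSet[F n] A → ∫⁻ ω in A, M (n + 1) ω ∂P ≤ ∫⁻ ω in A, M n ω ∂P)
    (c : ℝ≥0∞) :
    c * P {ω | ∃ n, c ≤ M n ω} ≤ ∫⁻ ω, M 0 ω ∂P := by
  set B : ℕ → Set Ω := fun n => {ω | ∀ j ≤ n, M j ω < c} with hB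
  have hBF : ∀ n, MeasurableSet[F n] (B n) := by
    intro n
    have hBn : B n = ⋂ j, ⋂ (_ : j ≤ n), {ω | M j ω < c} := by
      ext ω; simp [hB]
    rw [hBn]
    refine MeasurableSet.iInter fun j => MeasurableSet.iInter fun hj => ?_
    exact F.mono hj _ (hM j measurableSet_Iio)
  have hBm : ∀ n, MeasurableSet (B n) := fun n => F.le n _ (hBF n)
  have hMm : ∀ n, Measurable (M n) := fun n => (hM n).mono (F.le n) le_rfl
  have hge : ∀ n, MeasurableSet {ω | c ≤ M n ω} := fun n => hMm n measurableSet_Ici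
  have key : ∀ n, c * P (B n)ᶜ + ∫⁻ ω in B n, M n ω ∂P ≤ ∫⁻ ω, M 0 ω ∂P := by
    intro n
    induction n with
    | zero =>
      have hB0 : (B 0)ᶜ = {ω | c ≤ M 0 ω} := by ext ω; simp [hB]
      rw [← lintegral_add_compl (μ := P) (M 0) (hBm 0), add_comm (c * _)]
      refine add_le_add le_rfl ?_
      rw [hB0, ← setLIntegral_const]
      exact setLIntegral_mono (hMm 0) fun ω hω => hω
    | succ n ih =>
      refine le_trans ?_ ih
      set A : Set Ω := B n ∩ {ω | c ≤ M (n + 1) ω} with hA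
      have hsub : B (n + 1) = B n \ {ω | c ≤ M (n + 1) ω} := by
        ext ω
        simp only [hB, mem_ofPred_eq, Set.mem_sdiff, not_le]
        refine ⟨fun h => ⟨fun j hj => h j (by omega), h _ le_rfl⟩, fun h j hj => ?_⟩
        rcases Nat.le_succ_iff.mp hj with h1 | h1
        · exact h.1 j h1
        · rw [h1]; exact h.2
      have hcompl : (B (n + 1))ᶜ = (B n)ᶜ ∪ A := by
        rw [hsub, hA]
        ext ω
        simp only [mem_compl_iff, Set.mem_sdiff, mem_union, mem_inter_iff]
        tauto
      have h1 : P (B (n + 1))ᶜ ≤ P (B n)ᶜ + P A := by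
        rw [hcompl]; exact measure_union_le _ _
      have h2 : c * P A ≤ ∫⁻ ω in A, M (n + 1) ω ∂P := by
        rw [← setLIntegral_const]
        exact setLIntegral_mono (hMm _) fun ω hω => hω.2
      calc c * P (B (n + 1))ᶜ + ∫⁻ ω in B (n + 1), M (n + 1) ω ∂P
          ≤ c * (P (B n)ᶜ + P A) + ∫⁻ ω in B (n + 1), M (n + 1) ω ∂P := by gcongr
        _ = c * P (B n)ᶜ + (c * P A + ∫⁻ ω in B (n + 1), M (n + 1) ω ∂P) := by
            rw [mul_add, add_assoc]
        _ ≤ c * P (B n)ᶜ + (∫⁻ ω in A, M (n + 1) ω ∂P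
              + ∫⁻ ω in B (n + 1), M (n + 1) ω ∂P) := by gcongr
        _ = c * P (B n)ᶜ + ∫⁻ ω in B n, M (n + 1) ω ∂P := by
            rw [hsub, hA, lintegral_inter_add_sdiff _ _ (hge _)]
        _ ≤ c * P (B n)ᶜ + ∫⁻ ω in B n, M n ω ∂P := by
            gcongr 1
            exact hsuper n _ (hBF n)
  have hunion : {ω | ∃ n, c ≤ M n ω} = ⋃ n, (B n)ᶜ := by
    ext ω
    simp only [hB, mem_ofPred_eq, mem_iUnion, mem_compl_iff, not_forall, not_lt]
    exact ⟨fun ⟨n, hn⟩ => ⟨n, n, le_rfl, hn⟩, fun ⟨_, j, _, hj⟩ => ⟨j, hj⟩⟩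
  have hmono : Monotone fun n => (B n)ᶜ := fun m n hmn =>
    compl_subset_compl.mpr fun ω hω j hj => hω j (hj.trans hmn)
  rw [hunion, hmono.measure_iUnion, ENNReal.mul_iSup]
  exact iSup_le fun n => le_self_add.trans (key n)

theorem measurable_tsum_const_mul {Ω : Type*} {m : MeasurableSpace Ω} {g : ℕ → Ω → ℝ≥0∞}
    (hg : ∀ k, Measurable (g k)) (w : ℕ → ℝ≥0∞) : Measurable fun ω => ∑' k, w k * g k ω :=
  Measurable.tsum fun k => (hg k).const_mul _

theorem dmLam_pos {lam η : ℝ} (hlam : 0 < lam) (hη : 1 < η) (k : ℕ) : 0 < dmLam lam η k :=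
  div_pos hlam (Real.rpow_pos_of_pos (by linarith) _)

theorem dmLam_le {lam η : ℝ} (hlam : 0 < lam) (hη : 1 < η) (k : ℕ) : dmLam lam η k ≤ lam :=
  div_le_self hlam.le (Real.one_le_rpow hη.le (by positivity))

theorem dmLam_mul_sqrt {lam η : ℝ} (hη : 1 < η) (k : ℕ) :
    dmLam lam η k * Real.sqrt η = lam / η ^ k := by
  have h0 : 0 < η := by linarith
  have hs : 0 < Real.sqrt η := Real.sqrt_pos.mpr h0
  rw [dmLam, Real.rpow_add h0, Real.rpow_natCast, ← Real.sqrt_eq_rpow]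
  field_simp

theorem div_pow_mem_Ioc {lam η : ℝ} (hlam : 0 < lam) (hη : 1 < η) (k : ℕ) :
    lam / η ^ k ∈ Set.Ioc 0 lam :=
  ⟨by positivity, div_le_self hlam.le (one_le_pow₀ hη.le)⟩

theorem dmW_pos {lam η : ℝ} {f : ℝ → ℝ} (hlam : 0 < lam) (hη : 1 < η)
    (hfpos : ∀ l ∈ Set.Ioc 0 lam, 0 < f l) (k : ℕ) : 0 < dmW lam η f k := by
  have h1 := hfpos _ (div_pow_mem_Ioc hlam hη k)
  have h2 : 0 < η - 1 := by linarith
  rw [dmW, dmLam_mul_sqrt hη]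
  positivity

theorem sum_dmW_le_integral {lam η : ℝ} {f : ℝ → ℝ} (hlam : 0 < lam) (hη : 1 < η)
    (hfanti : AntitoneOn f (Set.Ioc 0 lam)) (hfint : IntegrableOn f (Set.Ioc 0 lam)) (n : ℕ) :
    ∑ k ∈ Finset.range n, dmW lam η f k ≤ ∫ x in (lam / η ^ n)..lam, f x := by
  induction n with
  | zero => simp
  | succ n ih =>
    have hm := div_pow_mem_Ioc hlam hη
    have hle : lam / η ^ (n + 1) ≤ lam / η ^ n := by
      have h0 : 0 < η := by linarith
      gcongr
      · exact hη.le
      · omega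
    have hii : ∀ a b, a ∈ Set.Ioc 0 lam → b ∈ Set.Ioc 0 lam → IntervalIntegrable f volume a b := by
      intro a b ha hb
      rw [intervalIntegrable_iff]
      exact hfint.mono_set fun x hx =>
        ⟨(lt_min ha.1 hb.1).trans hx.1, hx.2.trans (max_le ha.2 hb.2)⟩
    have hstep : dmW lam η f n ≤ ∫ x in (lam / η ^ (n + 1))..(lam / η ^ n), f x := by
      have hconst : dmW lam η f n
          = ∫ _ in (lam / η ^ (n + 1))..(lam / η ^ n), f (lam / η ^ n) := by
        rw [intervalIntegral.integral_const, dmW, dmLam_mul_sqrt hη, smul_eq_mul]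
        have h0 : 0 < η := by linarith
        field_simp
        ring
      rw [hconst]
      refine intervalIntegral.integral_mono_on hle intervalIntegrable_const
        (hii _ _ (hm _) (hm _)) fun x hx => ?_
      exact hfanti ⟨(hm (n + 1)).1.trans_le hx.1, hx.2.trans (hm n).2⟩ (hm n) hx.2
    rw [Finset.sum_range_succ, add_comm,
      ← intervalIntegral.integral_add_adjacent_intervals (hii _ _ (hm (n + 1)) (hm n))
        (hii _ _ (hm n) ⟨hlam, le_rfl⟩)]
    exact add_le_add hstep ih

theorem sum_dmW_le_one {lam η : ℝ} {f : ℝ → ℝ} (hlam : 0 < lam) (hη : 1 < η)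
    (hfpos : ∀ l ∈ Set.Ioc 0 lam, 0 < f l) (hfanti : AntitoneOn f (Set.Ioc 0 lam))
    (hfdens : (∫ l in Set.Ioc 0 lam, f l) = 1) (n : ℕ) :
    ∑ k ∈ Finset.range n, dmW lam η f k ≤ 1 := by
  have hfint : IntegrableOn f (Set.Ioc 0 lam) :=
    Integrable.of_integral_ne_zero (by rw [hfdens]; exact one_ne_zero)
  have hm := div_pow_mem_Ioc hlam hη n
  refine (sum_dmW_le_integral hlam hη hfanti hfint n).trans ?_
  rw [intervalIntegral.integral_of_le hm.2, ← hfdens]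
  exact setIntegral_mono_set hfint
    ((ae_restrict_mem measurableSet_Ioc).mono fun x hx => (hfpos x hx).le)
    (Ioc_subset_Ioc_left hm.1.le).eventuallyLE

/-- An exponential mixture with summable weights and bounded exponents attains the level `c`
at the supremum of its strict sublevel set. -/
theorem le_tsum_of_sSup_le {w l b : ℕ → ℝ} {lam c s : ℝ} (hw : ∀ k, 0 < w k)
    (hwsum : Summable w) (hl : ∀ k, 0 < l k) (hllam : ∀ k, l k ≤ lam)
    (hb : ∀ k, 0 ≤ b k)
    (hs : sSup {x : ℝ | ∑' k, w k * Real.exp (l k * x - b k) < c} ≤ s) :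
    Summable (fun k => w k * Real.exp (l k * s - b k)) ∧
      c ≤ ∑' k, w k * Real.exp (l k * s - b k) := by
  have hlam : 0 < lam := (hl 0).trans_le (hllam 0)
  have hbound : ∀ R : ℝ, 0 ≤ R → ∀ k, ∀ x ≤ R,
      ‖w k * Real.exp (l k * x - b k)‖ ≤ w k * Real.exp (lam * R) := by
    intro R hR k x hx
    rw [Real.norm_of_nonneg (mul_nonneg (hw k).le (Real.exp_pos _).le)]
    have h1 : l k * x ≤ l k * R := mul_le_mul_of_nonneg_left hx (hl k).le
    have h2 : l k * R ≤ lam * R := mul_le_mul_of_nonneg_right (hllam k) hR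
    have h3 := hb k
    exact mul_le_mul_of_nonneg_left (Real.exp_le_exp.mpr (by linarith)) (hw k).le
  have hsum : ∀ x, Summable (fun k => w k * Real.exp (l k * x - b k)) := fun x =>
    Summable.of_norm_bounded (hwsum.mul_right (Real.exp (lam * |x|)))
      fun k => hbound |x| (abs_nonneg x) k x (le_abs_self x)
  set g : ℝ → ℝ := fun x => ∑' k, w k * Real.exp (l k * x - b k) with hg
  have hcont : Continuous g := by
    refine continuous_iff_continuousAt.mpr fun x => ?_
    have hon : ContinuousOn g (Set.Iic (|x| + 1)) := by
      refine continuousOn_tsum (fun k => by fun_prop) (hwsum.mul_right (Real.exp (lam * (|x| + 1))))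
        fun k y hy => hbound (|x| + 1) (by positivity) k y hy
    exact hon.continuousAt (Iic_mem_nhds (by linarith [le_abs_self x]))
  have hmono : Monotone g := fun x y hxy => by
    refine Summable.tsum_le_tsum (fun k => ?_) (hsum x) (hsum y)
    have h1 : l k * x ≤ l k * y := mul_le_mul_of_nonneg_left hxy (hl k).le
    exact mul_le_mul_of_nonneg_left (Real.exp_le_exp.mpr (by linarith)) (hw k).le
  refine ⟨hsum s, ?_⟩
  have hbdd : BddAbove {x : ℝ | g x < c} := by
    have htend : Tendsto (fun x => w 0 * Real.exp (l 0 * x - b 0)) atTop atTop := by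
      refine Tendsto.const_mul_atTop (hw 0) (Real.tendsto_exp_atTop.comp ?_)
      exact tendsto_atTop_add_const_right _ (-b 0) (tendsto_id.const_mul_atTop (hl 0))
    obtain ⟨R, hR⟩ := (htend.eventually_ge_atTop c).exists
    refine ⟨R, fun x hx => le_of_not_gt fun hlt => ?_⟩
    have h1 : w 0 * Real.exp (l 0 * R - b 0) ≤ g R :=
      (hsum R).le_tsum 0 fun k _ => mul_nonneg (hw k).le (Real.exp_pos _).le
    exact absurd hx (not_lt.mpr ((hR.trans h1).trans (hmono hlt.le)))
  by_contra! hlt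
  obtain ⟨y, hsy, hy⟩ :=
    ((hcont.tendsto s).eventually_lt_const hlt).filter_mono (nhdsWithin_le_nhds (s := Set.Ioi s))
      |>.and self_mem_nhdsWithin |>.exists
  exact absurd ((le_csSup hbdd hsy).trans hs) (not_le.mpr hy)

/-- Theorem 2 (discrete mixture boundary): `DM_α` is an `l0`-sub-ψ uniform boundary with
crossing probability `α`. -/
theorem discrete_mixture_boundary
    (lmax : ℝ≥0∞) (ψ : ℝ → ℝ)
    (hψnn : ∀ l : ℝ, 0 ≤ l → ENNReal.ofReal l < lmax → 0 ≤ ψ l)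
    (α l0 lam η : ℝ)
    (hα : α ∈ Set.Ioo (0 : ℝ) 1) (hl0 : 1 ≤ l0)
    (hlam : 0 < lam) (hlamlt : ENNReal.ofReal lam < lmax) (hη : 1 < η)
    (f : ℝ → ℝ)
    (hfpos : ∀ l ∈ Set.Ioc 0 lam, 0 < f l)
    (hfanti : AntitoneOn f (Set.Ioc 0 lam))
    (hfdens : (∫ l in Set.Ioc 0 lam, f l) = 1)
    (Ω : Type*) (mΩ : MeasurableSpace Ω) (P : Measure Ω) [IsProbabilityMeasure P]
    (F : Filtration ℕ mΩ) (S V : ℕ → Ω → ℝ)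
    (hSV : IsSubPsiMeas P F {l : ℝ | 0 ≤ l ∧ ENNReal.ofReal l < lmax} ψ l0 S V) :
    P {ω | ∃ t : ℕ, 1 ≤ t ∧ dmBoundary lam η f ψ l0 α (V t ω) ≤ S t ω}
      ≤ ENNReal.ofReal α := by
  obtain ⟨-, -, -, -, hVnn, L, -, hL⟩ := hSV
  have hα0 : 0 < α := hα.1
  have hlpos := dmLam_pos hlam hη
  have hD : ∀ k, dmLam lam η k ∈ {l : ℝ | 0 ≤ l ∧ ENNReal.ofReal l < lmax} := fun k =>
    ⟨(hlpos k).le, (ENNReal.ofReal_le_ofReal (dmLam_le hlam hη k)).trans_lt hlamlt⟩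
  have hwpos := dmW_pos hlam hη hfpos
  have hw1 := sum_dmW_le_one hlam hη hfpos hfanti hfdens
  have hwsum : Summable (dmW lam η f) := summable_of_sum_range_le (fun k => (hwpos k).le) hw1
  have hwle : ∑' k, dmW lam η f k ≤ 1 := Real.tsum_le_of_sum_range_le (fun k => (hwpos k).le) hw1
  have hlevel : 1 < l0 / α := by
    rw [lt_div_iff₀ hα0]
    linarith [hα.2]
  set M : ℕ → Ω → ℝ≥0∞ := fun t ω =>
    ∑' k, ENNReal.ofReal (dmW lam η f k) * ENNReal.ofReal (L (dmLam lam η k) t ω) with hM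
  have hLmeas : ∀ k t, Measurable[F t] fun ω => ENNReal.ofReal (L (dmLam lam η k) t ω) :=
    fun k t => ENNReal.measurable_ofReal.comp ((hL _ (hD k)).1.stronglyAdapted t).measurable
  have hMmeas : ∀ t, Measurable[F t] (M t) := fun t =>
    measurable_tsum_const_mul (fun k => hLmeas k t) _
  have hlint : ∀ t (A : Set Ω), ∫⁻ ω in A, M t ω ∂P = ∑' k, ENNReal.ofReal (dmW lam η f k) *
      ENNReal.ofReal (∫ ω in A, L (dmLam lam η k) t ω ∂P) := by
    intro t A
    have hmeas : ∀ k, Measurable fun ω => ENNReal.ofReal (L (dmLam lam η k) t ω) :=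
      fun k => (hLmeas k t).mono (F.le t) le_rfl
    rw [hM, lintegral_tsum fun k => ((hmeas k).const_mul _).aemeasurable]
    refine tsum_congr fun k => ?_
    rw [lintegral_const_mul _ (hmeas k), ofReal_integral_eq_lintegral_ofReal
      ((hL _ (hD k)).1.integrable t).integrableOn (ae_of_all _ ((hL _ (hD k)).2.1 t))]
  have hsuper : ∀ t A, MeasurableSet[F t] A →
      ∫⁻ ω in A, M (t + 1) ω ∂P ≤ ∫⁻ ω in A, M t ω ∂P := by
    intro t A hA
    rw [hlint, hlint]
    exact ENNReal.tsum_le_tsum fun k => mul_le_mul_right (ENNReal.ofReal_le_ofReal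
      ((hL _ (hD k)).1.setIntegral_le t.le_succ hA)) _
  have hinit : ∫⁻ ω, M 0 ω ∂P ≤ ENNReal.ofReal l0 := by
    rw [← setLIntegral_univ, hlint]
    calc ∑' k, ENNReal.ofReal (dmW lam η f k) *
          ENNReal.ofReal (∫ ω in Set.univ, L (dmLam lam η k) 0 ω ∂P)
        ≤ ∑' k, ENNReal.ofReal (dmW lam η f k) * ENNReal.ofReal l0 := by
          gcongr with k
          rw [setIntegral_univ]
          exact (hL _ (hD k)).2.2.1
      _ = ENNReal.ofReal (∑' k, dmW lam η f k) * ENNReal.ofReal l0 := by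
          rw [ENNReal.tsum_mul_right, ENNReal.ofReal_tsum_of_nonneg (fun k => (hwpos k).le) hwsum]
      _ ≤ 1 * ENNReal.ofReal l0 := by
          gcongr
          exact ENNReal.ofReal_le_one.mpr hwle
      _ = ENNReal.ofReal l0 := one_mul _
  have hdom : ∀ᵐ ω ∂P, ∀ k t, Real.exp (dmLam lam η k * S t ω - ψ (dmLam lam η k) * V t ω)
      ≤ L (dmLam lam η k) t ω :=
    ae_all_iff.mpr fun k => ae_all_iff.mpr fun t => (hL _ (hD k)).2.2.2 t
  have hevent : P {ω | ∃ t : ℕ, 1 ≤ t ∧ dmBoundary lam η f ψ l0 α (V t ω) ≤ S t ω}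
      ≤ P {ω | ∃ t, ENNReal.ofReal (l0 / α) ≤ M t ω} := by
    refine measure_mono_ae ?_
    filter_upwards [hdom] with ω hω
    rintro ⟨t, -, ht⟩
    refine ⟨t, ?_⟩
    obtain ⟨hsum, hle⟩ := le_tsum_of_sSup_le hwpos hwsum hlpos
      (dmLam_le hlam hη) (fun k => mul_nonneg (hψnn _ (hD k).1 (hD k).2) (hVnn t ω)) ht
    refine (ENNReal.ofReal_le_ofReal hle).trans ?_
    rw [ENNReal.ofReal_tsum_of_nonneg
      (fun k => mul_nonneg (hwpos k).le (Real.exp_pos _).le) hsum]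
    refine ENNReal.tsum_le_tsum fun k => ?_
    rw [ENNReal.ofReal_mul (hwpos k).le]
    gcongr
    exact hω k t
  have hville := (mul_measure_exists_ge_le_lintegral P F M hMmeas hsuper
    (ENNReal.ofReal (l0 / α))).trans hinit
  refine hevent.trans ?_
  have hl0α : 0 < l0 / α := zero_lt_one.trans hlevel
  calc P {ω | ∃ t, ENNReal.ofReal (l0 / α) ≤ M t ω}
      ≤ ENNReal.ofReal l0 / ENNReal.ofReal (l0 / α) := by
        rw [ENNReal.le_div_iff_mul_le (Or.inl (ENNReal.ofReal_pos.mpr hl0α).ne')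
          (Or.inl ENNReal.ofReal_ne_top), mul_comm]
        exact hville
    _ = ENNReal.ofReal α := by
        rw [← ENNReal.ofReal_div_of_pos hl0α, div_div_cancel₀ (by positivity)]
end
end

section
/- Tuning the two-sided normal mixture boundary: Let u(v) := sqrt( (v + ρ) log( l0² (v + ρ) / (α² ρ) ) ) with parameters ρ > 0, α ∈ (0,1), l0 ≥ 1 satisfying α < l0. (a) For fixed ρ > 0, the function v ↦ u(v)/√v on (0, ∞) is uniquely minimized at v = m, where m > 0 is the unique solution with (m + ρ)/ρ ≥ 1 of the equation ((m + ρ)/ρ) · exp(−(m + ρ)/ρ) = α² / (e l0²) (equivalently, m/ρ = −W_{−1}(−α²/(e l0²)) − 1 with W_{−1} the lower branch of the Lambert W function). (b) For fixed m > 0, the value of ρ minimizing u(m) is determined by the same equation. -/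
open Set

noncomputable section

/-- The two-sided normal mixture boundary `u(v) = sqrt((v+ρ) log(l0²(v+ρ)/(α²ρ)))`. -/
def normalMixtureBdry (l0 α ρ v : ℝ) : ℝ :=
  Real.sqrt ((v + ρ) * Real.log (l0 ^ 2 * (v + ρ) / (α ^ 2 * ρ)))

/-- Logarithmic form of the tuning equation `s exp(-s) = α² / (e l0²)`. -/
lemma log_ratio_eq_of_mul_exp_neg {l0 α s : ℝ} (hl0 : 0 < l0) (hα : 0 < α) (hs : 0 < s)
    (h : s * Real.exp (-s) = α ^ 2 / (Real.exp 1 * l0 ^ 2)) :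
    Real.log (l0 ^ 2 / α ^ 2) = s - 1 - Real.log s := by
  have h1 := congrArg Real.log h
  rw [Real.log_mul hs.ne' (Real.exp_pos _).ne', Real.log_exp, Real.log_div (by positivity)
    (by positivity), Real.log_mul (by positivity) (by positivity), Real.log_exp] at h1
  rw [Real.log_div (by positivity) (by positivity)]
  linarith

/-- At `v` with `(v + ρ) / ρ = s`, where `s` solves the tuning equation, the squared boundary
equals `s * v`. -/
lemma normalMixtureBdry_eq_sqrt {l0 α ρ v : ℝ} (hl0 : 0 < l0) (hα : 0 < α) (hρ : 0 < ρ)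
    (hv : 0 < v)
    (h : ((v + ρ) / ρ) * Real.exp (-((v + ρ) / ρ)) = α ^ 2 / (Real.exp 1 * l0 ^ 2)) :
    normalMixtureBdry l0 α ρ v = Real.sqrt ((v + ρ) / ρ * v) := by
  have hL := log_ratio_eq_of_mul_exp_neg hl0 hα (by positivity) h
  have hsplit : l0 ^ 2 * (v + ρ) / (α ^ 2 * ρ) = l0 ^ 2 / α ^ 2 * ((v + ρ) / ρ) := by
    field_simp
  rw [normalMixtureBdry, hsplit, Real.log_mul (by positivity) (by positivity), hL]
  congr 1
  field_simp
  ring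

/-- If `s` solves the tuning equation, the boundary exceeds `sqrt (s * v)` away from
`(v + ρ) / ρ = s`. -/
lemma sqrt_lt_normalMixtureBdry {l0 α s ρ v : ℝ} (hl0 : 0 < l0) (hα : 0 < α) (hs : 0 < s)
    (h : s * Real.exp (-s) = α ^ 2 / (Real.exp 1 * l0 ^ 2))
    (hρ : 0 < ρ) (hv : 0 < v) (hne : (v + ρ) / ρ ≠ s) :
    Real.sqrt (s * v) < normalMixtureBdry l0 α ρ v := by
  have hL := log_ratio_eq_of_mul_exp_neg hl0 hα hs h
  have hsplit : l0 ^ 2 * (v + ρ) / (α ^ 2 * ρ) = l0 ^ 2 / α ^ 2 * ((v + ρ) / ρ) := by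
    field_simp
  rw [normalMixtureBdry, hsplit, Real.log_mul (by positivity) (by positivity), hL]
  apply Real.sqrt_lt_sqrt (by positivity)
  obtain ⟨t, ht⟩ : ∃ t, t = (v + ρ) / ρ := ⟨_, rfl⟩
  have ht0 : 0 < t := by rw [ht]; positivity
  have hvt : v + ρ = ρ * t := by rw [ht]; field_simp
  rw [← ht] at hne ⊢
  have hlog : Real.log (s / t) < s / t - 1 :=
    Real.log_lt_sub_one_of_pos (by positivity)
      (fun h1 => hne ((div_eq_one_iff_eq ht0.ne').1 h1).symm)
  rw [Real.log_div hs.ne' ht0.ne'] at hlog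
  have hmul := mul_lt_mul_of_pos_left hlog (mul_pos hρ ht0)
  have hdiv : ρ * t * (s / t - 1) = ρ * s - ρ * t := by field_simp
  rw [hdiv] at hmul
  rw [hvt, show v = ρ * t - ρ by linarith]
  linarith

/-- For fixed `ρ`, a solution of the tuning equation strictly minimizes `u(v) / √v`. -/
lemma normalMixtureBdry_div_sqrt_lt {l0 α ρ m v : ℝ} (hl0 : 0 < l0) (hα : 0 < α) (hρ : 0 < ρ)
    (hm : 0 < m)
    (h : ((m + ρ) / ρ) * Real.exp (-((m + ρ) / ρ)) = α ^ 2 / (Real.exp 1 * l0 ^ 2))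
    (hv : 0 < v) (hne : v ≠ m) :
    normalMixtureBdry l0 α ρ m / Real.sqrt m < normalMixtureBdry l0 α ρ v / Real.sqrt v := by
  have hs : 0 < (m + ρ) / ρ := by positivity
  have hlt := sqrt_lt_normalMixtureBdry hl0 hα hs h hρ hv (fun h1 => hne (by
    rw [div_left_inj' hρ.ne'] at h1
    linarith))
  rw [normalMixtureBdry_eq_sqrt hl0 hα hρ hm h, Real.sqrt_mul hs.le,
    mul_div_cancel_right₀ _ (Real.sqrt_pos.2 hm).ne', lt_div_iff₀ (Real.sqrt_pos.2 hv),
    ← Real.sqrt_mul hs.le]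
  exact hlt

/-- The map `s ↦ s - 1 - log s` takes every positive value on `(1, ∞)`. -/
lemma exists_sub_one_sub_log_eq {L : ℝ} (hL : 0 < L) :
    ∃ s : ℝ, 1 < s ∧ s - 1 - Real.log s = L := by
  have hle : (1 : ℝ) ≤ (2 + L) ^ 2 := by nlinarith
  have hcont : ContinuousOn (fun s : ℝ => s - 1 - Real.log s) (Icc 1 ((2 + L) ^ 2)) := by
    apply ContinuousOn.sub (by fun_prop)
    exact Real.continuousOn_log.mono fun x hx => (lt_of_lt_of_le one_pos hx.1).ne'
  have hlog : Real.log ((2 + L) ^ 2) ≤ 2 * (1 + L) := by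
    rw [Real.log_pow]
    have := Real.log_le_sub_one_of_pos (show 0 < 2 + L by linarith)
    push_cast
    linarith
  obtain ⟨s, hs, hsL⟩ := intermediate_value_Icc hle hcont
    (show L ∈ Icc _ _ from ⟨by simpa using hL.le, by nlinarith⟩)
  refine ⟨s, lt_of_le_of_ne hs.1 ?_, hsL⟩
  rintro rfl
  simp at hsL
  exact hL.ne hsL

/-- Proposition 3 (tuning the two-sided normal mixture boundary).
(a) For fixed `ρ > 0`, the map `v ↦ u(v)/√v` on `(0,∞)` is uniquely minimized at `v = m`,
where `m > 0` is given by `((m+ρ)/ρ) exp(−(m+ρ)/ρ) = α²/(e l0²)` (i.e.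
`m/ρ = −W_{−1}(−α²/(e l0²)) − 1`); such an `m` exists.
(b) For fixed `m > 0`, the `ρ` minimizing `u(m)` is determined by the same equation. -/
theorem normal_mixture_tuning
    (l0 α : ℝ) (hl0 : 1 ≤ l0) (hα : α ∈ Set.Ioo (0 : ℝ) 1) (hαl0 : α < l0) :
    -- (a) existence of the optimizer and unique minimality
    (∀ ρ : ℝ, 0 < ρ →
      ∃ m : ℝ, 0 < m ∧
        ((m + ρ) / ρ) * Real.exp (-((m + ρ) / ρ)) = α ^ 2 / (Real.exp 1 * l0 ^ 2) ∧
        ∀ v : ℝ, 0 < v → v ≠ m →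
          normalMixtureBdry l0 α ρ m / Real.sqrt m
            < normalMixtureBdry l0 α ρ v / Real.sqrt v) ∧
    -- uniqueness of the solution m of the characterizing equation
    (∀ ρ m m' : ℝ, 0 < ρ → 0 < m → 0 < m' →
      ((m + ρ) / ρ) * Real.exp (-((m + ρ) / ρ)) = α ^ 2 / (Real.exp 1 * l0 ^ 2) →
      ((m' + ρ) / ρ) * Real.exp (-((m' + ρ) / ρ)) = α ^ 2 / (Real.exp 1 * l0 ^ 2) →
      m = m') ∧
    -- (b) for fixed m, a ρ satisfying the same equation minimizes ρ' ↦ u_{ρ'}(m)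
    (∀ m ρ : ℝ, 0 < m → 0 < ρ →
      ((m + ρ) / ρ) * Real.exp (-((m + ρ) / ρ)) = α ^ 2 / (Real.exp 1 * l0 ^ 2) →
      ∀ ρ' : ℝ, 0 < ρ' → ρ' ≠ ρ →
        normalMixtureBdry l0 α ρ m < normalMixtureBdry l0 α ρ' m) := by
  have hα0 : 0 < α := hα.1
  have hl : 0 < l0 := by linarith
  refine ⟨fun ρ hρ => ?_, fun ρ m m' hρ hm hm' h h' => ?_, fun m ρ hm hρ h ρ' hρ' hne => ?_⟩
  · have hratio : 1 < l0 ^ 2 / α ^ 2 := by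
      rw [one_lt_div (by positivity)]
      gcongr
    obtain ⟨s, hs1, hs⟩ := exists_sub_one_sub_log_eq (Real.log_pos hratio)
    have hs0 : 0 < s := by linarith
    have hm : 0 < ρ * (s - 1) := mul_pos hρ (by linarith)
    have hms : (ρ * (s - 1) + ρ) / ρ = s := by field_simp; ring
    have heq : s * Real.exp (-s) = α ^ 2 / (Real.exp 1 * l0 ^ 2) := by
      apply Real.log_injOn_pos (mem_Ioi.2 (by positivity)) (mem_Ioi.2 (by positivity))
      rw [Real.log_div (by positivity) (by positivity)] at hs
      rw [Real.log_mul hs0.ne' (Real.exp_pos _).ne', Real.log_exp, Real.log_div (by positivity)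
        (by positivity), Real.log_mul (by positivity) (by positivity), Real.log_exp]
      linarith
    have h : ((ρ * (s - 1) + ρ) / ρ) * Real.exp (-((ρ * (s - 1) + ρ) / ρ))
        = α ^ 2 / (Real.exp 1 * l0 ^ 2) := by rw [hms, heq]
    exact ⟨_, hm, h, fun v hv hne => normalMixtureBdry_div_sqrt_lt hl hα0 hρ hm h hv hne⟩
  · by_contra hne
    exact lt_asymm (normalMixtureBdry_div_sqrt_lt hl hα0 hρ hm h hm' (Ne.symm hne))
      (normalMixtureBdry_div_sqrt_lt hl hα0 hρ hm' h' hm hne)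
  · rw [normalMixtureBdry_eq_sqrt hl hα0 hρ hm h]
    refine sqrt_lt_normalMixtureBdry hl hα0 (by positivity) h hρ' hm fun h1 => hne ?_
    field_simp at h1
    nlinarith
end
end

section
/- One-sided normal mixture boundary: Fix α ∈ (0,1), ρ > 0, l0 ≥ 1. Define NM_α(v) := sup{ s ∈ ℝ : sqrt(4ρ/(v + ρ)) · exp(s²/(2(v + ρ))) · Φ(s/√(v + ρ)) < l0/α }, where Φ is the standard normal CDF. Then NM_α is an l0-sub-ψ_N uniform boundary with crossing probability α (i.e., P(∃ t ≥ 1 : S_t ≥ NM_α(V_t)) ≤ α for every l0-sub-ψ_N pair (S_t, V_t) with jointly measurable witnessing supermartingales), and moreover NM_α(v) ≤ sqrt( 2 (v + ρ) log( (l0/(2α)) sqrt((v + ρ)/ρ) + 1 ) ) for all v ≥ 0. -/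
open MeasureTheory ProbabilityTheory Filter Set
open scoped ENNReal

noncomputable section

/-- The standard normal cumulative distribution function Φ. -/
def stdNormalCDF (x : ℝ) : ℝ :=
  ∫ u in Set.Iic x, Real.exp (-u ^ 2 / 2) / Real.sqrt (2 * Real.pi)

/-- The one-sided normal mixture boundary NM_α. -/
def oneSidedNormalMixture (l0 α ρ v : ℝ) : ℝ :=
  sSup {s : ℝ |
    Real.sqrt (4 * ρ / (v + ρ)) * Real.exp (s ^ 2 / (2 * (v + ρ)))
      * stdNormalCDF (s / Real.sqrt (v + ρ)) < l0 / α}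

namespace MeasureTheory.Supermartingale

variable {Ω : Type*} {mΩ : MeasurableSpace Ω} {P : Measure Ω} {F : Filtration ℕ mΩ}
  {L : ℕ → Ω → ℝ} {A : ℕ → Set Ω}

/-- Optional stopping for a family of disjoint adapted events, keeping the part of the mass
that has not been stopped before time `k`. -/
theorem sum_setIntegral_add_setIntegral_compl_le [IsFiniteMeasure P] (hL : Supermartingale L F P)
    (hA : ∀ t, MeasurableSet[F t] (A t)) (hd : Pairwise (Function.onFun Disjoint A)) (k : ℕ) :
    ∑ t ∈ Finset.range k, ∫ ω in A t, L t ω ∂P + ∫ ω in (⋃ t ∈ Finset.range k, A t)ᶜ, L k ω ∂P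
      ≤ ∫ ω, L 0 ω ∂P := by
  induction k with
  | zero => simp
  | succ k ih =>
    refine le_trans ?_ ih
    have hmeas : MeasurableSet[F k] (⋃ t ∈ Finset.range (k + 1), A t)ᶜ :=
      (Finset.measurableSet_biUnion _ fun t ht ↦
        F.mono (Nat.lt_succ_iff.mp (Finset.mem_range.mp ht)) _ (hA t)).compl
    have hsplit : (⋃ t ∈ Finset.range k, A t)ᶜ
        = A k ∪ (⋃ t ∈ Finset.range (k + 1), A t)ᶜ := by
      have hsub : A k ⊆ (⋃ t ∈ Finset.range k, A t)ᶜ := by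
        rw [subset_compl_iff_disjoint_right, disjoint_iUnion₂_right]
        exact fun t ht ↦ hd (Finset.mem_range.mp ht).ne'
      rw [Finset.range_add_one, Finset.set_biUnion_insert, compl_union, union_inter_distrib_left,
        union_compl_self, univ_inter, union_eq_self_of_subset_left hsub]
    have hdisj : Disjoint (A k) (⋃ t ∈ Finset.range (k + 1), A t)ᶜ := by
      rw [disjoint_compl_right_iff_subset]
      exact subset_biUnion_of_mem (u := A) (Finset.mem_coe.mpr (Finset.self_mem_range_succ k))
    rw [hsplit, setIntegral_union hdisj (F.le k _ hmeas) (hL.integrable k).integrableOn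
      (hL.integrable k).integrableOn, Finset.sum_range_succ]
    linarith [hL.setIntegral_le (Nat.le_succ k) hmeas]

theorem sum_setLIntegral_ofReal_le [IsFiniteMeasure P] (hL : Supermartingale L F P)
    (hnn : ∀ t ω, 0 ≤ L t ω) (hA : ∀ t, MeasurableSet[F t] (A t))
    (hd : Pairwise (Function.onFun Disjoint A)) (k : ℕ) :
    ∑ t ∈ Finset.range k, ∫⁻ ω in A t, ENNReal.ofReal (L t ω) ∂P
      ≤ ENNReal.ofReal (∫ ω, L 0 ω ∂P) := by
  have hterm (t : ℕ) : ∫⁻ ω in A t, ENNReal.ofReal (L t ω) ∂P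
      = ENNReal.ofReal (∫ ω in A t, L t ω ∂P) :=
    (ofReal_integral_eq_lintegral_ofReal (hL.integrable t).integrableOn
      (ae_of_all _ (hnn t))).symm
  simp_rw [hterm]
  rw [← ENNReal.ofReal_sum_of_nonneg fun t _ ↦ integral_nonneg (hnn t)]
  refine ENNReal.ofReal_le_ofReal ?_
  have hrest : 0 ≤ ∫ ω in (⋃ t ∈ Finset.range k, A t)ᶜ, L k ω ∂P := integral_nonneg (hnn k)
  linarith [hL.sum_setIntegral_add_setIntegral_compl_le hA hd k]

end MeasureTheory.Supermartingale

theorem integrable_exp_neg_sq_div_two : Integrable fun u : ℝ ↦ Real.exp (-u ^ 2 / 2) := by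
  refine (integrable_exp_neg_mul_sq (b := 1 / 2) (by norm_num)).congr (ae_of_all _ fun u ↦ ?_)
  ring_nf

theorem integral_exp_neg_sq_div_two : ∫ u : ℝ, Real.exp (-u ^ 2 / 2) = √(2 * Real.pi) := by
  rw [show 2 * Real.pi = Real.pi / (1 / 2) by ring, ← integral_gaussian]
  congr 1 with u; ring_nf

theorem integrable_stdNormalDensity :
    Integrable fun u : ℝ ↦ Real.exp (-u ^ 2 / 2) / √(2 * Real.pi) :=
  integrable_exp_neg_sq_div_two.div_const _

theorem continuous_stdNormalCDF : Continuous stdNormalCDF := by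
  have h : stdNormalCDF = fun x ↦ stdNormalCDF 0
      + ∫ u in (0 : ℝ)..x, Real.exp (-u ^ 2 / 2) / √(2 * Real.pi) := by
    ext x
    rw [← intervalIntegral.integral_Iic_sub_Iic integrable_stdNormalDensity.integrableOn
      integrable_stdNormalDensity.integrableOn]
    simp [stdNormalCDF]
  rw [h]
  exact continuous_const.add (intervalIntegral.continuous_primitive
    (fun _ _ ↦ integrable_stdNormalDensity.intervalIntegrable) 0)

theorem one_sub_stdNormalCDF_le {x : ℝ} (hx : 0 ≤ x) :
    1 - stdNormalCDF x ≤ Real.exp (-x ^ 2 / 2) := by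
  have hpi : 0 < √(2 * Real.pi) := by positivity
  have htotal : ∫ u : ℝ, Real.exp (-u ^ 2 / 2) / √(2 * Real.pi) = 1 := by
    rw [integral_div, integral_exp_neg_sq_div_two, div_self hpi.ne']
  have htail : 1 - stdNormalCDF x
      = ∫ u in Ioi x, Real.exp (-u ^ 2 / 2) / √(2 * Real.pi) := by
    rw [← htotal, stdNormalCDF, ← compl_Iic,
      ← integral_add_compl (measurableSet_Iic (a := x)) integrable_stdNormalDensity,
      add_sub_cancel_left]
  have hshift : Integrable fun u : ℝ ↦
      Real.exp (-x ^ 2 / 2) * (Real.exp (-(u - x) ^ 2 / 2) / √(2 * Real.pi)) :=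
    (integrable_stdNormalDensity.comp_sub_right x).const_mul _
  calc 1 - stdNormalCDF x
      ≤ ∫ u in Ioi x, Real.exp (-x ^ 2 / 2) * (Real.exp (-(u - x) ^ 2 / 2) / √(2 * Real.pi)) := by
        rw [htail]
        refine setIntegral_mono_on integrable_stdNormalDensity.integrableOn hshift.integrableOn
          measurableSet_Ioi fun u hu ↦ ?_
        rw [← mul_div_assoc, ← Real.exp_add]
        gcongr
        nlinarith [mem_Ioi.mp hu]
    _ ≤ ∫ u, Real.exp (-x ^ 2 / 2) * (Real.exp (-(u - x) ^ 2 / 2) / √(2 * Real.pi)) :=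
        setIntegral_le_integral hshift (ae_of_all _ fun _ ↦ by positivity)
    _ = Real.exp (-x ^ 2 / 2) := by
        rw [integral_const_mul,
          integral_sub_right_eq_self (fun u ↦ Real.exp (-u ^ 2 / 2) / √(2 * Real.pi)), htotal,
          mul_one]

/-- The mixture of `exp (l * s - l ^ 2 / 2 * v)` over a half-normal `l` with precision `ρ`,
where `w = v + ρ`. -/
def halfNormalMixture (ρ w s : ℝ) : ℝ :=
  √(4 * ρ / w) * Real.exp (s ^ 2 / (2 * w)) * stdNormalCDF (s / √w)

theorem continuous_halfNormalMixture (ρ w : ℝ) : Continuous (halfNormalMixture ρ w) := by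
  have := continuous_stdNormalCDF
  unfold halfNormalMixture
  fun_prop

theorem measurable_uncurry_halfNormalMixture (ρ : ℝ) :
    Measurable (Function.uncurry (halfNormalMixture ρ)) := by
  have := continuous_stdNormalCDF.measurable
  unfold halfNormalMixture Function.uncurry
  fun_prop

theorem sq_le_of_halfNormalMixture_lt {ρ w s c : ℝ} (hρ : 0 < ρ) (hw : 0 < w) (hs : 0 ≤ s)
    (h : halfNormalMixture ρ w s < c) : s ^ 2 ≤ 2 * w * Real.log (c / 2 * √(w / ρ) + 1) := by
  have hx2 : (s / √w) ^ 2 / 2 = s ^ 2 / (2 * w) := by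
    rw [div_pow, Real.sq_sqrt hw.le]; field_simp
  have htail := one_sub_stdNormalCDF_le (x := s / √w) (by positivity)
  rw [neg_div, hx2, Real.exp_neg] at htail
  have hexp : Real.exp (s ^ 2 / (2 * w))
      ≤ Real.exp (s ^ 2 / (2 * w)) * stdNormalCDF (s / √w) + 1 := by
    have h' := mul_le_mul_of_nonneg_left htail (Real.exp_pos (s ^ 2 / (2 * w))).le
    rw [mul_inv_cancel₀ (Real.exp_ne_zero _)] at h'
    linarith
  have hsqrt : √(4 * ρ / w) * (√(w / ρ) / 2) = 1 := by
    rw [← mul_div_assoc, ← Real.sqrt_mul (by positivity),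
      show 4 * ρ / w * (w / ρ) = 2 ^ 2 by field_simp; norm_num, Real.sqrt_sq (by norm_num)]
    norm_num
  have hmix : Real.exp (s ^ 2 / (2 * w)) * stdNormalCDF (s / √w) ≤ c / 2 * √(w / ρ) := by
    calc _ = halfNormalMixture ρ w s * (√(w / ρ) / 2) := by
          unfold halfNormalMixture
          linear_combination (- Real.exp (s ^ 2 / (2 * w)) * stdNormalCDF (s / √w)) * hsqrt
      _ ≤ c * (√(w / ρ) / 2) := by gcongr
      _ = _ := by ring
  have hlog : s ^ 2 / (2 * w) ≤ Real.log (c / 2 * √(w / ρ) + 1) := by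
    rw [← Real.log_exp (s ^ 2 / (2 * w))]
    exact Real.log_le_log (Real.exp_pos _) (by linarith)
  rwa [div_le_iff₀' (by positivity)] at hlog

theorem le_sqrt_of_halfNormalMixture_lt {ρ w s c : ℝ} (hρ : 0 < ρ) (hw : 0 < w)
    (h : halfNormalMixture ρ w s < c) : s ≤ √(2 * w * Real.log (c / 2 * √(w / ρ) + 1)) := by
  rcases le_or_gt 0 s with hs | hs
  · exact Real.le_sqrt_of_sq_le (sq_le_of_halfNormalMixture_lt hρ hw hs h)
  · exact hs.le.trans (Real.sqrt_nonneg _)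

theorem le_halfNormalMixture_of_oneSidedNormalMixture_le {l0 α ρ v s : ℝ} (hρ : 0 < ρ)
    (hv : 0 ≤ v) (h : oneSidedNormalMixture l0 α ρ v ≤ s) :
    l0 / α ≤ halfNormalMixture ρ (v + ρ) s := by
  by_contra! hlt
  have hbdd : BddAbove {x | halfNormalMixture ρ (v + ρ) x < l0 / α} :=
    ⟨_, fun x hx ↦ le_sqrt_of_halfNormalMixture_lt hρ (by positivity) hx⟩
  have hnear : ∀ᶠ x in nhdsWithin s (Ioi s), halfNormalMixture ρ (v + ρ) x < l0 / α :=
    nhdsWithin_le_nhds ((continuous_halfNormalMixture ρ _).continuousAt.eventually_lt_const hlt)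
  obtain ⟨x, hx, hsx⟩ := (hnear.and self_mem_nhdsWithin).exists
  exact ((le_csSup hbdd hx).trans h).not_gt hsx

theorem integral_Ioi_exp_linear_sub_sq {w : ℝ} (hw : 0 < w) (s : ℝ) :
    ∫ l in Ioi 0, Real.exp (l * s - l ^ 2 / 2 * w)
      = Real.exp (s ^ 2 / (2 * w)) * (√(2 * Real.pi) / √w * stdNormalCDF (s / √w)) := by
  have hr : 0 < √w := Real.sqrt_pos.mpr hw
  have hsq : √w ^ 2 = w := Real.sq_sqrt hw.le
  set r := √w
  set g : ℝ → ℝ := (Iic (s / r)).indicator fun u ↦ Real.exp (-u ^ 2 / 2)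
  have hg : ∫ u, g u = √(2 * Real.pi) * stdNormalCDF (s / r) := by
    rw [integral_indicator measurableSet_Iic, stdNormalCDF, integral_div,
      mul_div_cancel₀ _ (by positivity)]
  have hcomp : ∫ l, g (s / r - r * l) = r⁻¹ * ∫ u, g u := by
    rw [Measure.integral_comp_mul_left (fun y ↦ g (s / r - y)) r, integral_sub_left_eq_self,
      abs_of_pos (inv_pos.mpr hr), smul_eq_mul]
  have hset : ∫ l in Ioi 0, Real.exp (l * s - l ^ 2 / 2 * w)
      = ∫ l, Real.exp (s ^ 2 / (2 * w)) * g (s / r - r * l) := by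
    rw [← integral_Ici_eq_integral_Ioi, ← integral_indicator measurableSet_Ici]
    congr 1 with l
    by_cases hl : 0 ≤ l
    · have hmem : s / r - r * l ∈ Iic (s / r) := by
        simpa using mul_nonneg hr.le hl
      rw [indicator_of_mem (mem_Ici.mpr hl), show g _ = _ from indicator_of_mem hmem _, ← Real.exp_add, ← hsq]
      congr 1
      field_simp
      ring
    · have hmem : s / r - r * l ∉ Iic (s / r) := by
        simpa using mul_neg_of_pos_of_neg hr (not_le.mp hl)
      rw [indicator_of_notMem (by simpa using hl), show g _ = _ from indicator_of_notMem hmem _,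
        mul_zero]
  rw [hset, integral_const_mul, hcomp, hg]
  ring

theorem integrable_exp_linear_sub_sq {w : ℝ} (hw : 0 < w) (s : ℝ) :
    Integrable fun l : ℝ ↦ Real.exp (l * s - l ^ 2 / 2 * w) := by
  have h := ((integrable_exp_neg_mul_sq (b := w / 2) (by positivity)).comp_sub_right
    (s / w)).const_mul (Real.exp (s ^ 2 / (2 * w)))
  refine h.congr (ae_of_all _ fun l ↦ ?_)
  simp only
  rw [← Real.exp_add]
  congr 1
  field_simp
  ring

/-- The half-normal distribution with precision `ρ`, that is, the law of `|Z|` for a centered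
Gaussian `Z` of variance `1 / ρ`. -/
def halfNormal (ρ : ℝ) : Measure ℝ :=
  (volume.restrict (Ioi 0)).withDensity fun l ↦
    ENNReal.ofReal (√(2 * ρ / Real.pi) * Real.exp (-(ρ / 2) * l ^ 2))

theorem lintegral_halfNormal_ofReal (ρ : ℝ) {f : ℝ → ℝ} (hf : Measurable f) :
    ∫⁻ l, ENNReal.ofReal (f l) ∂halfNormal ρ
      = ∫⁻ l in Ioi 0,
          ENNReal.ofReal (√(2 * ρ / Real.pi) * (Real.exp (-(ρ / 2) * l ^ 2) * f l)) := by
  rw [halfNormal, lintegral_withDensity_eq_lintegral_mul _ (by fun_prop) (by fun_prop)]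
  refine lintegral_congr fun l ↦ ?_
  rw [Pi.mul_apply, ← ENNReal.ofReal_mul (by positivity), mul_assoc]

theorem isProbabilityMeasure_halfNormal {ρ : ℝ} (hρ : 0 < ρ) :
    IsProbabilityMeasure (halfNormal ρ) := by
  refine ⟨?_⟩
  have h := lintegral_halfNormal_ofReal ρ (f := fun _ ↦ 1) measurable_const
  simp only [ENNReal.ofReal_one, lintegral_const, one_mul, mul_one] at h
  rw [h, ← ofReal_integral_eq_lintegral_ofReal
    ((integrable_exp_neg_mul_sq (by positivity)).const_mul _).integrableOn
    (ae_of_all _ fun _ ↦ by positivity), integral_const_mul, integral_gaussian_Ioi,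
    ← mul_div_assoc, ← Real.sqrt_mul (by positivity),
    show 2 * ρ / Real.pi * (Real.pi / (ρ / 2)) = 2 ^ 2 by field_simp,
    Real.sqrt_sq (by norm_num)]
  norm_num

theorem ae_halfNormal_pos (ρ : ℝ) : ∀ᵐ l ∂halfNormal ρ, 0 < l :=
  (withDensity_absolutelyContinuous _ _).ae_le (ae_restrict_mem measurableSet_Ioi)

theorem lintegral_halfNormal_exp {ρ v : ℝ} (hρ : 0 < ρ) (hv : 0 ≤ v) (s : ℝ) :
    ∫⁻ l, ENNReal.ofReal (Real.exp (l * s - l ^ 2 / 2 * v)) ∂halfNormal ρ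
      = ENNReal.ofReal (halfNormalMixture ρ (v + ρ) s) := by
  have hw : 0 < v + ρ := by positivity
  have hexp (l : ℝ) : Real.exp (-(ρ / 2) * l ^ 2) * Real.exp (l * s - l ^ 2 / 2 * v)
      = Real.exp (l * s - l ^ 2 / 2 * (v + ρ)) := by
    rw [← Real.exp_add]; congr 1; ring
  rw [lintegral_halfNormal_ofReal ρ (by fun_prop)]
  simp_rw [hexp]
  rw [← ofReal_integral_eq_lintegral_ofReal
    ((integrable_exp_linear_sub_sq hw s).const_mul _).integrableOn
    (ae_of_all _ fun _ ↦ by positivity), integral_const_mul, integral_Ioi_exp_linear_sub_sq hw]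
  have hconst : √(2 * ρ / Real.pi) * (√(2 * Real.pi) / √(v + ρ)) = √(4 * ρ / (v + ρ)) := by
    rw [← mul_div_assoc, ← Real.sqrt_mul (by positivity), ← Real.sqrt_div (by positivity)]
    congr 2
    field_simp
    norm_num
  rw [halfNormalMixture, ← hconst]
  congr 1
  ring

theorem IsSubPsiMeas.measure_exists_le_halfNormalMixture_le {Ω : Type*} {mΩ : MeasurableSpace Ω}
    {P : Measure Ω} [IsFiniteMeasure P] {F : Filtration ℕ mΩ} {S V : ℕ → Ω → ℝ} {l0 ρ c : ℝ}
    (h : IsSubPsiMeas P F (Ici 0) (fun l ↦ l ^ 2 / 2) l0 S V) (hρ : 0 < ρ) :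
    ENNReal.ofReal c * P {ω | ∃ t, c ≤ halfNormalMixture ρ (V t ω + ρ) (S t ω)}
      ≤ ENNReal.ofReal l0 := by
  obtain ⟨hS, hV, -, -, hV0, L, -, hL⟩ := h
  have hSm (t : ℕ) : Measurable (S t) := (hS t).mono (F.le t) le_rfl
  have hVm (t : ℕ) : Measurable (V t) := (hV t).mono (F.le t) le_rfl
  have := isProbabilityMeasure_halfNormal hρ
  set E : ℕ → Set Ω := fun t ↦ {ω | c ≤ halfNormalMixture ρ (V t ω + ρ) (S t ω)} with hE
  have hEm (t : ℕ) : MeasurableSet[F t] (E t) :=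
    measurableSet_le measurable_const
      ((measurable_uncurry_halfNormalMixture ρ).comp (((hV t).add_const ρ).prodMk (hS t)))
  have hAm (t : ℕ) : MeasurableSet[F t] (disjointed E t) := by
    rw [disjointed_eq_inter_compl]
    exact (hEm t).inter (MeasurableSet.biInter (to_countable _) fun i hi ↦
      (F.mono (le_of_lt hi) _ (hEm i)).compl)
  have hbound (k : ℕ) (l : ℝ) (hl : 0 ≤ l) :
      ∑ t ∈ Finset.range k, ∫⁻ ω in disjointed E t,
        ENNReal.ofReal (Real.exp (l * S t ω - l ^ 2 / 2 * V t ω)) ∂P ≤ ENNReal.ofReal l0 := by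
    obtain ⟨hsuper, hnn, h0, hle⟩ := hL l hl
    refine le_trans (Finset.sum_le_sum fun t _ ↦ lintegral_mono_ae ?_)
      ((hsuper.sum_setLIntegral_ofReal_le hnn hAm (disjoint_disjointed E) k).trans
        (ENNReal.ofReal_le_ofReal h0))
    filter_upwards [ae_restrict_of_ae (hle t)] with ω hω using ENNReal.ofReal_le_ofReal hω
  have hmix (k : ℕ) : ∑ t ∈ Finset.range k, ENNReal.ofReal c * P (disjointed E t)
      ≤ ENNReal.ofReal l0 := by
    calc ∑ t ∈ Finset.range k, ENNReal.ofReal c * P (disjointed E t)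
        ≤ ∑ t ∈ Finset.range k, ∫⁻ ω in disjointed E t, (∫⁻ l,
            ENNReal.ofReal (Real.exp (l * S t ω - l ^ 2 / 2 * V t ω)) ∂halfNormal ρ) ∂P := by
          refine Finset.sum_le_sum fun t _ ↦ ?_
          rw [← setLIntegral_const]
          refine setLIntegral_mono' (F.le t _ (hAm t)) fun ω hω ↦ ?_
          rw [lintegral_halfNormal_exp hρ (hV0 t ω)]
          exact ENNReal.ofReal_le_ofReal (disjointed_subset E t hω)
      _ = ∫⁻ l, ∑ t ∈ Finset.range k, (∫⁻ ω in disjointed E t,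
            ENNReal.ofReal (Real.exp (l * S t ω - l ^ 2 / 2 * V t ω)) ∂P) ∂halfNormal ρ := by
          have hjoint (t : ℕ) : Measurable (Function.uncurry fun (ω : Ω) (l : ℝ) ↦
              ENNReal.ofReal (Real.exp (l * S t ω - l ^ 2 / 2 * V t ω))) := by
            unfold Function.uncurry
            fun_prop
          rw [lintegral_finsetSum _ fun t _ ↦ Measurable.lintegral_prod_left (hjoint t)]
          exact Finset.sum_congr rfl fun t _ ↦ lintegral_lintegral_swap (hjoint t).aemeasurable
      _ ≤ ∫⁻ _, ENNReal.ofReal l0 ∂halfNormal ρ := by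
          refine lintegral_mono_ae ?_
          filter_upwards [ae_halfNormal_pos ρ] with l hl using hbound k l hl.le
      _ = ENNReal.ofReal l0 := by simp
  have hunion : {ω | ∃ t, c ≤ halfNormalMixture ρ (V t ω + ρ) (S t ω)} = ⋃ t, disjointed E t := by
    rw [iUnion_disjointed]
    ext ω
    simp [hE]
  rw [hunion, measure_iUnion (disjoint_disjointed E) fun t ↦ F.le t _ (hAm t),
    ← ENNReal.tsum_mul_left]
  exact ENNReal.tsum_le_of_sum_range_le hmix

/-- Proposition (one-sided normal mixture): `NM_α` is an `l0`-sub-ψ_N uniform boundary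
with crossing probability `α`, and it admits the stated closed-form upper bound. -/
theorem one_sided_normal_mixture
    (α ρ l0 : ℝ) (hα : α ∈ Set.Ioo (0 : ℝ) 1) (hρ : 0 < ρ) (hl0 : 1 ≤ l0) :
    (∀ (Ω : Type) (mΩ : MeasurableSpace Ω) (P : Measure Ω),
      IsProbabilityMeasure P →
      ∀ (F : Filtration ℕ mΩ) (S V : ℕ → Ω → ℝ),
        IsSubPsiMeas P F (Set.Ici 0) (fun l => l ^ 2 / 2) l0 S V →
        P {ω | ∃ t : ℕ, 1 ≤ t ∧ oneSidedNormalMixture l0 α ρ (V t ω) ≤ S t ω}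
          ≤ ENNReal.ofReal α) ∧
    (∀ v : ℝ, 0 ≤ v →
      oneSidedNormalMixture l0 α ρ v
        ≤ Real.sqrt (2 * (v + ρ)
            * Real.log (l0 / (2 * α) * Real.sqrt ((v + ρ) / ρ) + 1))) := by
  refine ⟨fun Ω mΩ P hP F S V h ↦ ?_, fun v hv ↦ ?_⟩
  · have hα0 : 0 < α := hα.1
    have hc : 0 < l0 / α := by positivity
    have hsub : {ω | ∃ t : ℕ, 1 ≤ t ∧ oneSidedNormalMixture l0 α ρ (V t ω) ≤ S t ω}
        ⊆ {ω | ∃ t, l0 / α ≤ halfNormalMixture ρ (V t ω + ρ) (S t ω)} := by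
      rintro ω ⟨t, -, ht⟩
      exact ⟨t, le_halfNormalMixture_of_oneSidedNormalMixture_le hρ (h.2.2.2.2.1 t ω) ht⟩
    refine (measure_mono hsub).trans ?_
    have hville := h.measure_exists_le_halfNormalMixture_le (c := l0 / α) hρ
    rw [mul_comm, ← ENNReal.le_div_iff_mul_le (by simp [hc]) (by simp),
      ← ENNReal.ofReal_div_of_pos hc, div_div_cancel₀ (by positivity)] at hville
    exact hville
  · refine Real.sSup_le (fun s hs ↦ ?_) (Real.sqrt_nonneg _)
    rw [mul_comm 2 α, ← div_div]
    exact le_sqrt_of_halfNormalMixture_lt hρ (by positivity) hs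
end
end

section
/- Two-sided normal mixture boundary: Suppose both (S_t) and (−S_t) are l0-sub-ψ_N with variance process (V_t), with jointly measurable witnessing supermartingales. Fix α ∈ (0,1) and ρ > 0, and define u(v) := sqrt( (v + ρ) log( l0² (v + ρ) / (α² ρ) ) ). Then P(∀ t ≥ 1 : |S_t| < u(V_t)) ≥ 1 − α. -/
open MeasureTheory ProbabilityTheory Filter Set
open scoped ENNReal

noncomputable section

/-- The event that none of the events `E 0, …, E (n - 1)` occurs. -/
def noneBefore {Ω : Type*} (E : ℕ → Set Ω) (n : ℕ) : Set Ω := {ω | ∀ s < n, ω ∉ E s}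

lemma noneBefore_zero {Ω : Type*} (E : ℕ → Set Ω) : noneBefore E 0 = univ := by
  simp [noneBefore]

lemma noneBefore_succ {Ω : Type*} (E : ℕ → Set Ω) (n : ℕ) :
    noneBefore E (n + 1) = noneBefore E n \ E n := by
  ext ω
  exact Nat.forall_lt_succ_right

lemma measurableSet_noneBefore {Ω : Type*} {mΩ : MeasurableSpace Ω} {F : Filtration ℕ mΩ}
    {E : ℕ → Set Ω} (hE : ∀ t, MeasurableSet[F t] (E t)) {m n : ℕ} (hmn : n ≤ m + 1) :
    MeasurableSet[F m] (noneBefore E n) := by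
  induction n with
  | zero => rw [noneBefore_zero]; exact MeasurableSet.univ
  | succ n ih =>
    rw [noneBefore_succ]
    exact (ih (by omega)).diff (F.mono (by omega) _ (hE n))

lemma iUnion_subset_iUnion_noneBefore_inter {Ω : Type*} (E : ℕ → Set Ω) :
    ⋃ t, E t ⊆ ⋃ t, noneBefore E t ∩ E t := by
  classical
  intro ω hω
  have h : ∃ t, ω ∈ E t := by simpa using hω
  exact mem_iUnion.2 ⟨Nat.find h, fun s hs => Nat.find_min h hs, Nat.find_spec h⟩

/-- Optional stopping at the first occurrence of the adapted events `E`. -/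
lemma MeasureTheory.Supermartingale.sum_setIntegral_add_le {Ω : Type*} {mΩ : MeasurableSpace Ω}
    {P : Measure Ω} [IsFiniteMeasure P] {F : Filtration ℕ mΩ} {L : ℕ → Ω → ℝ}
    (hL : Supermartingale L F P) {E : ℕ → Set Ω} (hE : ∀ t, MeasurableSet[F t] (E t)) (n : ℕ) :
    ∑ t ∈ Finset.range n, ∫ ω in noneBefore E t ∩ E t, L t ω ∂P
      + ∫ ω in noneBefore E n, L n ω ∂P ≤ ∫ ω, L 0 ω ∂P := by
  induction n with
  | zero => simp [noneBefore_zero]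
  | succ n ih =>
    have hmono := hL.setIntegral_le (Nat.le_succ n) (measurableSet_noneBefore hE (le_refl (n + 1)))
    have hsplit := integral_inter_add_sdiff (s := noneBefore E n) (F.le n _ (hE n))
      (hL.integrable n).integrableOn
    rw [← noneBefore_succ] at hsplit
    rw [Finset.sum_range_succ]
    simp only [Nat.succ_eq_add_one] at hmono
    linarith

lemma MeasureTheory.Supermartingale.sum_setLIntegral_le {Ω : Type*} {mΩ : MeasurableSpace Ω}
    {P : Measure Ω} [IsFiniteMeasure P] {F : Filtration ℕ mΩ} {L X : ℕ → Ω → ℝ}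
    (hL : Supermartingale L F P) (hL0 : ∀ t ω, 0 ≤ L t ω) (hXL : ∀ t, ∀ᵐ ω ∂P, X t ω ≤ L t ω)
    {E : ℕ → Set Ω} (hE : ∀ t, MeasurableSet[F t] (E t)) (n : ℕ) :
    ∑ t ∈ Finset.range n, ∫⁻ ω in noneBefore E t ∩ E t, ENNReal.ofReal (X t ω) ∂P
      ≤ ENNReal.ofReal (∫ ω, L 0 ω ∂P) := by
  calc _ ≤ ∑ t ∈ Finset.range n, ENNReal.ofReal (∫ ω in noneBefore E t ∩ E t, L t ω ∂P) := by
        refine Finset.sum_le_sum fun t _ => ?_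
        rw [ofReal_integral_eq_lintegral_ofReal (hL.integrable t).integrableOn
          (ae_of_all _ (hL0 t))]
        refine lintegral_mono_ae (ae_restrict_of_ae ?_)
        filter_upwards [hXL t] with ω hω using ENNReal.ofReal_le_ofReal hω
    _ = ENNReal.ofReal (∑ t ∈ Finset.range n, ∫ ω in noneBefore E t ∩ E t, L t ω ∂P) :=
        (ENNReal.ofReal_sum_of_nonneg fun t _ => integral_nonneg (hL0 t)).symm
    _ ≤ _ := by
        refine ENNReal.ofReal_le_ofReal (le_trans ?_ (hL.sum_setIntegral_add_le hE n))
        exact le_add_of_nonneg_right (integral_nonneg (hL0 n))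

lemma lintegral_exp_gaussianReal {ρ v : ℝ} (hρ : 0 < ρ) (hv : 0 ≤ v) (s : ℝ) :
    ∫⁻ l, ENNReal.ofReal (Real.exp (l * s - l ^ 2 / 2 * v))
        ∂gaussianReal 0 (Real.toNNReal ρ⁻¹)
      = ENNReal.ofReal (Real.sqrt (ρ / (v + ρ)) * Real.exp (s ^ 2 / (2 * (v + ρ)))) := by
  have hvρ : 0 < v + ρ := by linarith
  have h1 : Real.toNNReal ρ⁻¹ ≠ 0 := by simpa using hρ
  have h2 : Real.toNNReal (v + ρ)⁻¹ ≠ 0 := by simpa using hvρ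
  have hdens : ∀ l : ℝ, gaussianPDFReal 0 (Real.toNNReal ρ⁻¹) l
        * Real.exp (l * s - l ^ 2 / 2 * v)
      = (Real.sqrt (ρ / (v + ρ)) * Real.exp (s ^ 2 / (2 * (v + ρ))))
        * gaussianPDFReal (s / (v + ρ)) (Real.toNNReal (v + ρ)⁻¹) l := by
    intro l
    simp only [gaussianPDFReal, Real.coe_toNNReal _ (inv_nonneg.2 hρ.le),
      Real.coe_toNNReal _ (inv_nonneg.2 hvρ.le)]
    have hc : (Real.sqrt (2 * Real.pi * ρ⁻¹))⁻¹
        = Real.sqrt (ρ / (v + ρ)) * (Real.sqrt (2 * Real.pi * (v + ρ)⁻¹))⁻¹ := by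
      rw [← Real.sqrt_inv, ← Real.sqrt_inv, ← Real.sqrt_mul (by positivity)]
      congr 1
      field_simp
    have hexp : Real.exp (-(l - 0) ^ 2 / (2 * ρ⁻¹)) * Real.exp (l * s - l ^ 2 / 2 * v)
        = Real.exp (s ^ 2 / (2 * (v + ρ)))
          * Real.exp (-(l - s / (v + ρ)) ^ 2 / (2 * (v + ρ)⁻¹)) := by
      rw [← Real.exp_add, ← Real.exp_add]
      congr 1
      field_simp
      ring
    rw [mul_assoc, hexp, hc]
    ring
  rw [gaussianReal_of_var_ne_zero _ h1,
    lintegral_withDensity_eq_lintegral_mul _ (measurable_gaussianPDF _ _) (by fun_prop)]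
  calc _ = ∫⁻ l, ENNReal.ofReal (Real.sqrt (ρ / (v + ρ)) * Real.exp (s ^ 2 / (2 * (v + ρ))))
        * gaussianPDF (s / (v + ρ)) (Real.toNNReal (v + ρ)⁻¹) l := by
        refine lintegral_congr fun l => ?_
        rw [Pi.mul_apply, gaussianPDF, gaussianPDF,
          ← ENNReal.ofReal_mul (gaussianPDFReal_nonneg _ _ _), hdens,
          ENNReal.ofReal_mul (by positivity)]
    _ = _ := by
        rw [lintegral_const_mul _ (measurable_gaussianPDF _ _),
          lintegral_gaussianPDF_eq_one _ h2, mul_one]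

lemma le_normal_mixture_of_boundary_le {l0 α ρ s v : ℝ} (hl0 : 0 < l0) (hα : 0 < α) (hρ : 0 < ρ)
    (hv : 0 ≤ v)
    (h : Real.sqrt ((v + ρ) * Real.log (l0 ^ 2 * (v + ρ) / (α ^ 2 * ρ))) ≤ |s|) :
    l0 / α ≤ Real.sqrt (ρ / (v + ρ)) * Real.exp (s ^ 2 / (2 * (v + ρ))) := by
  have hvρ : 0 < v + ρ := by linarith
  have h1 : (v + ρ) * Real.log (l0 ^ 2 * (v + ρ) / (α ^ 2 * ρ)) ≤ s ^ 2 := by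
    rw [← sq_abs s]
    exact (Real.sqrt_le_left (abs_nonneg s)).1 h
  have h2 : l0 ^ 2 * (v + ρ) / (α ^ 2 * ρ) ≤ Real.exp (s ^ 2 / (v + ρ)) := by
    rw [← Real.log_le_iff_le_exp (by positivity), le_div_iff₀ hvρ, mul_comm]
    exact h1
  refine le_of_sq_le_sq ?_ (by positivity)
  rw [mul_pow, Real.sq_sqrt (by positivity), ← Real.exp_nat_mul]
  calc (l0 / α) ^ 2 = ρ / (v + ρ) * (l0 ^ 2 * (v + ρ) / (α ^ 2 * ρ)) := by field_simp
    _ ≤ ρ / (v + ρ) * Real.exp (s ^ 2 / (v + ρ)) := by gcongr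
    _ = _ := by
      congr 2
      push_cast
      field_simp

/-- Proposition (two-sided normal mixture boundary): if both `(S_t)` and `(−S_t)` are
`l0`-sub-ψ_N with variance process `(V_t)`, then with
`u(v) = sqrt((v+ρ) log(l0²(v+ρ)/(α²ρ)))` we have `P(∀ t ≥ 1 : |S_t| < u(V_t)) ≥ 1 − α`. -/
theorem two_sided_normal_mixture
    {Ω : Type*} {mΩ : MeasurableSpace Ω} (P : Measure Ω) [IsProbabilityMeasure P]
    (F : Filtration ℕ mΩ) (l0 : ℝ) (hl0 : 1 ≤ l0)
    (α ρ : ℝ) (hα : α ∈ Set.Ioo (0 : ℝ) 1) (hρ : 0 < ρ)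
    (S V : ℕ → Ω → ℝ)
    (hS : IsSubPsiMeas P F (Set.Ici 0) (fun l => l ^ 2 / 2) l0 S V)
    (hnegS : IsSubPsiMeas P F (Set.Ici 0) (fun l => l ^ 2 / 2) l0
      (fun t ω => -S t ω) V) :
    ENNReal.ofReal (1 - α) ≤
      P {ω | ∀ t : ℕ, 1 ≤ t →
        |S t ω| < Real.sqrt ((V t ω + ρ)
          * Real.log (l0 ^ 2 * (V t ω + ρ) / (α ^ 2 * ρ)))} := by
  obtain ⟨hSa, hVa, -, -, hV0, L, -, hL⟩ := hS
  obtain ⟨-, -, -, -, -, L', -, hL'⟩ := hnegS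
  have hα0 : 0 < α := hα.1
  have hl0' : 0 < l0 := by linarith
  have hSm : ∀ t, Measurable (S t) := fun t => (hSa t).mono (F.le t) le_rfl
  have hVm : ∀ t, Measurable (V t) := fun t => (hVa t).mono (F.le t) le_rfl
  set u : ℝ → ℝ := fun v => Real.sqrt ((v + ρ) * Real.log (l0 ^ 2 * (v + ρ) / (α ^ 2 * ρ)))
  have hum : Measurable u := by fun_prop
  set E : ℕ → Set Ω := fun t => {ω | u (V t ω) ≤ |S t ω|} with hEdef
  have hE : ∀ t, MeasurableSet[F t] (E t) := fun t =>
    measurableSet_le (hum.comp (hVa t)) (continuous_abs.measurable.comp (hSa t))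
  have hE' : ∀ t, MeasurableSet (noneBefore E t ∩ E t) := fun t =>
    F.le t _ ((measurableSet_noneBefore hE (Nat.le_succ t)).inter (hE t))
  have hsum : ∀ (l : ℝ) (n : ℕ), ∑ t ∈ Finset.range n, ∫⁻ ω in noneBefore E t ∩ E t,
      ENNReal.ofReal (Real.exp (l * S t ω - l ^ 2 / 2 * V t ω)) ∂P ≤ ENNReal.ofReal l0 := by
    intro l n
    rcases le_total 0 l with hl | hl
    · obtain ⟨hsup, hnn, hint, hle⟩ := hL l hl
      exact (hsup.sum_setLIntegral_le hnn hle hE n).trans (ENNReal.ofReal_le_ofReal hint)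
    · obtain ⟨hsup, hnn, hint, hle⟩ := hL' (-l) (neg_nonneg.2 hl)
      simp only [neg_mul_neg, neg_sq] at hle
      exact (hsup.sum_setLIntegral_le hnn hle hE n).trans (ENNReal.ofReal_le_ofReal hint)
  have hmix : ∀ t, ENNReal.ofReal (l0 / α) * P (noneBefore E t ∩ E t) ≤
      ∫⁻ l, ∫⁻ ω in noneBefore E t ∩ E t,
        ENNReal.ofReal (Real.exp (l * S t ω - l ^ 2 / 2 * V t ω)) ∂P
        ∂gaussianReal 0 (Real.toNNReal ρ⁻¹) := by
    intro t
    have := hSm t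
    have := hVm t
    rw [lintegral_lintegral_swap (by fun_prop), ← setLIntegral_const]
    refine setLIntegral_mono' (hE' t) fun ω hω => ?_
    rw [lintegral_exp_gaussianReal hρ (hV0 t ω)]
    exact ENNReal.ofReal_le_ofReal (le_normal_mixture_of_boundary_le hl0' hα0 hρ (hV0 t ω) hω.2)
  have hpartial : ∀ n, ∑ t ∈ Finset.range n, P (noneBefore E t ∩ E t) ≤ ENNReal.ofReal α := by
    intro n
    have hle : ENNReal.ofReal (l0 / α) * ∑ t ∈ Finset.range n, P (noneBefore E t ∩ E t)
        ≤ ENNReal.ofReal (l0 / α) * ENNReal.ofReal α := by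
      rw [← ENNReal.ofReal_mul (by positivity), div_mul_cancel₀ _ hα0.ne', Finset.mul_sum]
      refine (Finset.sum_le_sum fun t _ => hmix t).trans ?_
      rw [← lintegral_finsetSum']
      · refine (lintegral_mono fun l => hsum l n).trans ?_
        simp
      · intro t _
        have := hSm t
        have := hVm t
        refine (Measurable.lintegral_prod_right' (f := fun p : ℝ × Ω =>
          ENNReal.ofReal (Real.exp (p.1 * S t p.2 - p.1 ^ 2 / 2 * V t p.2))) ?_).aemeasurable
        fun_prop
    exact (ENNReal.mul_le_mul_iff_right (by simpa using div_pos hl0' hα0)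
      ENNReal.ofReal_ne_top).1 hle
  have hbad : P (⋃ t, E t) ≤ ENNReal.ofReal α :=
    (measure_mono (iUnion_subset_iUnion_noneBefore_inter E)).trans
      ((measure_iUnion_le _).trans (ENNReal.tsum_le_of_sum_range_le hpartial))
  have hgood : (⋃ t, E t)ᶜ ⊆ {ω | ∀ t : ℕ, 1 ≤ t → |S t ω| < u (V t ω)} := by
    intro ω hω t _
    simp only [hEdef, mem_compl_iff, mem_iUnion, mem_ofPred_eq, not_exists, not_le] at hω
    exact hω t
  refine le_trans ?_ (measure_mono hgood)
  rw [prob_compl_eq_one_sub (MeasurableSet.iUnion fun t => F.le t _ (hE t)),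
    ENNReal.ofReal_sub _ hα0.le, ENNReal.ofReal_one]
  exact tsub_le_tsub_left hbad 1
end
end

section
/- Gamma-exponential mixture boundary: Fix c > 0, ρ > 0, α ∈ (0,1), l0 ≥ 1. Define m(s, v) := [ (ρ/c²)^{ρ/c²} / ( Γ(ρ/c²) γ(ρ/c², ρ/c²) ) ] · [ Γ((v+ρ)/c²) γ((v+ρ)/c², (cs+v+ρ)/c²) / ((cs+v+ρ)/c²)^{(v+ρ)/c²} ] · exp((cs+v)/c²), and GE_α(v) := sup{ s ≥ 0 : m(s, v) < l0/α }. Then m(s, v) equals the mixture integral ∫_0^{1/c} exp(λ s − ψ_{E,c}(λ) v) f(λ) dλ, where f(λ) := [γ(ρ/c², ρ/c²)]^{−1} · ((ρ/c)^{ρ/c²}/Γ(ρ/c²)) · (c^{−1} − λ)^{ρ/c² − 1} e^{−ρ(c^{−1} − λ)/c}, and consequently GE_α is an l0-sub-ψ_{E,c} uniform boundary with crossing probability α. -/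
open MeasureTheory ProbabilityTheory Filter Set
open scoped ENNReal

noncomputable section

/-- ψ_{E,c}(λ) = c⁻²(−log(1 − cλ) − cλ), the sub-exponential ψ function. -/
def psiE (c l : ℝ) : ℝ := (-Real.log (1 - c * l) - c * l) / c ^ 2

/-- The regularized lower incomplete gamma function γ(a, x). -/
def regLowGamma (a x : ℝ) : ℝ :=
  (∫ u in Set.Ioc (0 : ℝ) x, u ^ (a - 1) * Real.exp (-u)) / Real.Gamma a

/-- The gamma-exponential mixture function m(s, v). -/
def geM (c ρ s v : ℝ) : ℝ :=
  ((ρ / c ^ 2) ^ (ρ / c ^ 2)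
      / (Real.Gamma (ρ / c ^ 2) * regLowGamma (ρ / c ^ 2) (ρ / c ^ 2)))
    * (Real.Gamma ((v + ρ) / c ^ 2)
        * regLowGamma ((v + ρ) / c ^ 2) ((c * s + v + ρ) / c ^ 2)
        / ((c * s + v + ρ) / c ^ 2) ^ ((v + ρ) / c ^ 2))
    * Real.exp ((c * s + v) / c ^ 2)

/-- The gamma-exponential mixture boundary GE_α. -/
def geBoundary (c ρ l0 α v : ℝ) : ℝ :=
  sSup {s : ℝ | 0 ≤ s ∧ geM c ρ s v < l0 / α}

/-- The truncated gamma mixing density on `[0, 1/c]`. -/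
def geMixDensity (c ρ l : ℝ) : ℝ :=
  (1 / regLowGamma (ρ / c ^ 2) (ρ / c ^ 2))
    * ((ρ / c) ^ (ρ / c ^ 2) / Real.Gamma (ρ / c ^ 2))
    * (1 / c - l) ^ (ρ / c ^ 2 - 1) * Real.exp (-ρ * (1 / c - l) / c)

lemma geMixDensity_mul_exp_eq {c ρ s v l : ℝ} (hc : 0 < c) (hρ : 0 < ρ) (hs : 0 ≤ s)
    (hv : 0 ≤ v) (hl : l < 1 / c) :
    Real.exp (l * s - psiE c l * v) * geMixDensity c ρ l =
      1 / regLowGamma (ρ / c ^ 2) (ρ / c ^ 2) * ((ρ / c) ^ (ρ / c ^ 2) / Real.Gamma (ρ / c ^ 2)) *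
        c ^ (v / c ^ 2) * Real.exp ((c * s + v) / c ^ 2) *
        ((c * s + v + ρ) / c) ^ (1 - (v + ρ) / c ^ 2) *
        (((c * s + v + ρ) / c * (1 / c) - (c * s + v + ρ) / c * l) ^ ((v + ρ) / c ^ 2 - 1) *
          Real.exp (-((c * s + v + ρ) / c * (1 / c) - (c * s + v + ρ) / c * l))) := by
  obtain ⟨x, rfl⟩ : ∃ x, l = 1 / c - x := ⟨1 / c - l, by ring⟩
  have hx : 0 < x := by linarith
  have hb : 0 < (c * s + v + ρ) / c := by positivity
  set b := (c * s + v + ρ) / c with hbdef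
  have e1 : b * (1 / c) - b * (1 / c - x) = b * x := by ring
  have e2 : 1 / c - (1 / c - x) = x := by ring
  have e3 : 1 - c * (1 / c - x) = c * x := by field_simp; ring
  rw [e1, geMixDensity, e2, psiE, e3, Real.mul_rpow hb.le hx.le]
  have e4 : b ^ (1 - (v + ρ) / c ^ 2) * b ^ ((v + ρ) / c ^ 2 - 1) = 1 := by
    rw [← Real.rpow_add hb]; simp
  have e5 : x ^ ((v + ρ) / c ^ 2 - 1) = x ^ (v / c ^ 2) * x ^ (ρ / c ^ 2 - 1) := by
    rw [← Real.rpow_add hx]; congr 1; ring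
  have e6 : Real.exp ((1 / c - x) * s - (-Real.log (c * x) - c * (1 / c - x)) / c ^ 2 * v) *
      Real.exp (-ρ * x / c) =
      c ^ (v / c ^ 2) * x ^ (v / c ^ 2) * Real.exp ((c * s + v) / c ^ 2) * Real.exp (-(b * x)) := by
    rw [← Real.mul_rpow hc.le hx.le, Real.rpow_def_of_pos (by positivity), ← Real.exp_add,
      ← Real.exp_add, ← Real.exp_add, hbdef]
    congr 1
    field_simp
    ring
  rw [e5]
  linear_combination (1 / regLowGamma (ρ / c ^ 2) (ρ / c ^ 2) *
    ((ρ / c) ^ (ρ / c ^ 2) / Real.Gamma (ρ / c ^ 2)) * x ^ (ρ / c ^ 2 - 1)) * e6 -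
    (1 / regLowGamma (ρ / c ^ 2) (ρ / c ^ 2) *
    ((ρ / c) ^ (ρ / c ^ 2) / Real.Gamma (ρ / c ^ 2)) * x ^ (ρ / c ^ 2 - 1) *
      c ^ (v / c ^ 2) * x ^ (v / c ^ 2) * Real.exp ((c * s + v) / c ^ 2) * Real.exp (-(b * x))) * e4

lemma intervalIntegrable_rpow_mul_exp_neg {a B : ℝ} (ha : 0 < a) (hB : 0 ≤ B) :
    IntervalIntegrable (fun u : ℝ => u ^ (a - 1) * Real.exp (-u)) volume 0 B := by
  rw [intervalIntegrable_iff_integrableOn_Ioc_of_le hB]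
  refine ((Real.GammaIntegral_convergent ha).mono_set Ioc_subset_Ioi_self).congr_fun ?_
    measurableSet_Ioc
  intro u _
  exact mul_comm _ _

lemma regLowGamma_pos {a x : ℝ} (ha : 0 < a) (hx : 0 < x) : 0 < regLowGamma a x := by
  rw [regLowGamma, ← intervalIntegral.integral_of_le hx.le]
  refine div_pos ?_ (Real.Gamma_pos_of_pos ha)
  refine intervalIntegral.intervalIntegral_pos_of_pos_on
    (intervalIntegrable_rpow_mul_exp_neg ha hx.le) (fun u hu => ?_) hx
  have := hu.1
  positivity

lemma geMixDensity_pos {c ρ l : ℝ} (hc : 0 < c) (hρ : 0 < ρ) (hl : l < 1 / c) :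
    0 < geMixDensity c ρ l := by
  have h1 : 0 < 1 / c - l := by linarith
  have h2 := regLowGamma_pos (a := ρ / c ^ 2) (x := ρ / c ^ 2) (by positivity) (by positivity)
  have h3 : 0 < Real.Gamma (ρ / c ^ 2) := Real.Gamma_pos_of_pos (by positivity)
  rw [geMixDensity]
  positivity

lemma integrableOn_exp_mul_geMixDensity {c ρ s v : ℝ} (hc : 0 < c) (hρ : 0 < ρ) (hs : 0 ≤ s)
    (hv : 0 ≤ v) :
    IntegrableOn (fun l => Real.exp (l * s - psiE c l * v) * geMixDensity c ρ l)
      (Ioo 0 (1 / c)) := by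
  have hb : 0 < (c * s + v + ρ) / c := by positivity
  have ha : 0 < (v + ρ) / c ^ 2 := by positivity
  have hB : 0 ≤ (c * s + v + ρ) / c * (1 / c) := by positivity
  have h1 := (intervalIntegrable_rpow_mul_exp_neg ha hB).symm
  have h2 := (h1.comp_sub_left ((c * s + v + ρ) / c * (1 / c))).comp_mul_left
    (c := (c * s + v + ρ) / c)
  rw [sub_self, sub_zero, zero_div, mul_div_cancel_left₀ _ hb.ne',
    intervalIntegrable_iff_integrableOn_Ioo_of_le (by positivity)] at h2
  refine IntegrableOn.congr_fun (h2.const_mul (1 / regLowGamma (ρ / c ^ 2) (ρ / c ^ 2) *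
    ((ρ / c) ^ (ρ / c ^ 2) / Real.Gamma (ρ / c ^ 2)) *
        c ^ (v / c ^ 2) * Real.exp ((c * s + v) / c ^ 2) *
        ((c * s + v + ρ) / c) ^ (1 - (v + ρ) / c ^ 2))) ?_ measurableSet_Ioo
  intro l hl
  exact (geMixDensity_mul_exp_eq hc hρ hs hv hl.2).symm

lemma geM_eq_integral {c ρ s v : ℝ} (hc : 0 < c) (hρ : 0 < ρ) (hs : 0 ≤ s) (hv : 0 ≤ v) :
    geM c ρ s v = ∫ l in Ioo (0 : ℝ) (1 / c),
      Real.exp (l * s - psiE c l * v) * geMixDensity c ρ l := by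
  have hb : 0 < (c * s + v + ρ) / c := by positivity
  have ha : 0 < (v + ρ) / c ^ 2 := by positivity
  have hr : 0 < ρ / c ^ 2 := by positivity
  rw [setIntegral_congr_fun measurableSet_Ioo
    (fun l hl => geMixDensity_mul_exp_eq hc hρ hs hv hl.2), integral_const_mul,
    ← integral_Ioc_eq_integral_Ioo, ← intervalIntegral.integral_of_le (by positivity),
    intervalIntegral.integral_comp_sub_mul (fun u => u ^ ((v + ρ) / c ^ 2 - 1) * Real.exp (-u))
      hb.ne']
  have hB : (c * s + v + ρ) / c * (1 / c) = (c * s + v + ρ) / c ^ 2 := by field_simp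
  rw [sub_self, mul_zero, sub_zero, intervalIntegral.integral_of_le (by positivity), hB, geM]
  have h3 := Real.Gamma_pos_of_pos ha
  have h4 := Real.Gamma_pos_of_pos hr
  have h5 := regLowGamma_pos hr hr
  have h6 : Real.Gamma ((v + ρ) / c ^ 2) *
      regLowGamma ((v + ρ) / c ^ 2) ((c * s + v + ρ) / c ^ 2) =
      ∫ u in Ioc (0 : ℝ) ((c * s + v + ρ) / c ^ 2),
        u ^ ((v + ρ) / c ^ 2 - 1) * Real.exp (-u) := by
    rw [regLowGamma]; field_simp
  rw [h6, smul_eq_mul]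
  set I := ∫ u in Ioc (0 : ℝ) ((c * s + v + ρ) / c ^ 2),
        u ^ ((v + ρ) / c ^ 2 - 1) * Real.exp (-u)
  set b := (c * s + v + ρ) / c with hbdef
  have e1 : (c * s + v + ρ) / c ^ 2 = b / c := by rw [hbdef]; field_simp
  have e2 : ρ / c = ρ / c ^ 2 * c := by field_simp
  have e3 : c ^ ((v + ρ) / c ^ 2) = c ^ (ρ / c ^ 2) * c ^ (v / c ^ 2) := by
    rw [← Real.rpow_add hc]; congr 1; ring
  rw [e1, e2, Real.div_rpow hb.le hc.le, Real.mul_rpow hr.le hc.le, Real.rpow_sub hb,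
    Real.rpow_one, e3]
  have : 0 < b ^ ((v + ρ) / c ^ 2) := by positivity
  field_simp

lemma geM_zero_zero {c ρ : ℝ} (hc : 0 < c) (hρ : 0 < ρ) : geM c ρ 0 0 = 1 := by
  have hr : 0 < ρ / c ^ 2 := by positivity
  have h4 := Real.Gamma_pos_of_pos hr
  have h5 := regLowGamma_pos hr hr
  have h6 : 0 < (ρ / c ^ 2) ^ (ρ / c ^ 2) := by positivity
  simp only [geM, mul_zero, zero_add, zero_div, Real.exp_zero, mul_one]
  field_simp

lemma psiE_nonneg {c l : ℝ} (hc : 0 < c) (hl : l < 1 / c) : 0 ≤ psiE c l := by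
  have h1 : 0 < 1 - c * l := by
    rw [lt_div_iff₀ hc] at hl
    linarith
  have h2 := Real.log_le_sub_one_of_pos h1
  exact div_nonneg (by linarith) (by positivity)

lemma geM_zero_le_one {c ρ v : ℝ} (hc : 0 < c) (hρ : 0 < ρ) (hv : 0 ≤ v) :
    geM c ρ 0 v ≤ 1 := by
  rw [← geM_zero_zero hc hρ, geM_eq_integral hc hρ le_rfl hv,
    geM_eq_integral hc hρ le_rfl le_rfl]
  refine setIntegral_mono_on (integrableOn_exp_mul_geMixDensity hc hρ le_rfl hv)
    (integrableOn_exp_mul_geMixDensity hc hρ le_rfl le_rfl) measurableSet_Ioo fun l hl => ?_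
  refine mul_le_mul_of_nonneg_right (Real.exp_le_exp.2 ?_) (geMixDensity_pos hc hρ hl.2).le
  have := mul_nonneg (psiE_nonneg hc hl.2) hv
  linarith

lemma geM_add_le {c ρ s v δ : ℝ} (hc : 0 < c) (hρ : 0 < ρ) (hs : 0 ≤ s) (hv : 0 ≤ v)
    (hδ : 0 ≤ δ) : geM c ρ (s + δ) v ≤ Real.exp (δ / c) * geM c ρ s v := by
  rw [geM_eq_integral hc hρ hs hv, geM_eq_integral hc hρ (add_nonneg hs hδ) hv,
    ← integral_const_mul]
  refine setIntegral_mono_on (integrableOn_exp_mul_geMixDensity hc hρ (add_nonneg hs hδ) hv)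
    ((integrableOn_exp_mul_geMixDensity hc hρ hs hv).const_mul _) measurableSet_Ioo fun l hl => ?_
  rw [← mul_assoc, ← Real.exp_add]
  refine mul_le_mul_of_nonneg_right (Real.exp_le_exp.2 ?_) (geMixDensity_pos hc hρ hl.2).le
  have h := mul_le_mul_of_nonneg_right hl.2.le hδ
  have e : 1 / c * δ = δ / c := by ring
  linarith

lemma exists_pos_mul_le_geM {c ρ v : ℝ} (hc : 0 < c) (hρ : 0 < ρ) (hv : 0 ≤ v) :
    ∃ κ > 0, ∀ s, 0 ≤ s → κ * s ≤ geM c ρ s v := by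
  have hint : IntegrableOn
      (fun l => l * (Real.exp (l * 0 - psiE c l * v) * geMixDensity c ρ l)) (Ioo 0 (1 / c)) := by
    refine (integrableOn_exp_mul_geMixDensity hc hρ le_rfl hv).bdd_mul (c := 1 / c)
      measurable_id.aestronglyMeasurable ?_
    refine (ae_restrict_iff' measurableSet_Ioo).2 (ae_of_all _ fun l hl => ?_)
    change ‖l‖ ≤ 1 / c
    rw [Real.norm_of_nonneg hl.1.le]
    exact hl.2.le
  refine ⟨∫ l in Ioo (0 : ℝ) (1 / c),
    l * (Real.exp (l * 0 - psiE c l * v) * geMixDensity c ρ l), ?_, fun s hs => ?_⟩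
  · rw [← integral_Ioc_eq_integral_Ioo, ← intervalIntegral.integral_of_le (by positivity)]
    refine intervalIntegral.intervalIntegral_pos_of_pos_on
      ((intervalIntegrable_iff_integrableOn_Ioo_of_le (by positivity)).2 hint)
      (fun l hl => ?_) (by positivity)
    exact mul_pos hl.1 (mul_pos (Real.exp_pos _) (geMixDensity_pos hc hρ hl.2))
  · rw [geM_eq_integral hc hρ hs hv, ← integral_mul_const]
    refine setIntegral_mono_on (hint.mul_const _)
      (integrableOn_exp_mul_geMixDensity hc hρ hs hv) measurableSet_Ioo fun l hl => ?_
    have h1 : l * s ≤ Real.exp (l * s) := by linarith [Real.add_one_le_exp (l * s)]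
    have h2 : 0 ≤ Real.exp (-(psiE c l * v)) * geMixDensity c ρ l :=
      mul_nonneg (Real.exp_pos _).le (geMixDensity_pos hc hρ hl.2).le
    have h3 := mul_le_mul_of_nonneg_right h1 h2
    rw [sub_eq_add_neg (l * s), Real.exp_add, mul_zero, zero_sub]
    linarith

lemma le_geM_of_geBoundary_le {c ρ l0 α s v : ℝ} (hc : 0 < c) (hρ : 0 < ρ)
    (hK : 1 < l0 / α) (hv : 0 ≤ v) (hs : geBoundary c ρ l0 α v ≤ s) :
    0 ≤ s ∧ l0 / α ≤ geM c ρ s v := by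
  have hbdd : BddAbove {s : ℝ | 0 ≤ s ∧ geM c ρ s v < l0 / α} := by
    obtain ⟨κ, hκ, h⟩ := exists_pos_mul_le_geM hc hρ hv
    refine ⟨l0 / α / κ, fun x hx => ?_⟩
    rw [le_div_iff₀' hκ]
    exact (h x hx.1).trans hx.2.le
  have hs0 : 0 ≤ s :=
    (le_csSup hbdd ⟨le_rfl, (geM_zero_le_one hc hρ hv).trans_lt hK⟩).trans hs
  refine ⟨hs0, ?_⟩
  by_contra! hlt
  have hcont : Tendsto (fun δ : ℝ => Real.exp (δ / c) * geM c ρ s v) (nhdsWithin 0 (Ioi 0))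
      (nhds (Real.exp (0 / c) * geM c ρ s v)) :=
    (Continuous.tendsto (by fun_prop) 0).mono_left nhdsWithin_le_nhds
  have hev := hcont.eventually_lt_const (u := l0 / α) (by simpa using hlt)
  obtain ⟨δ, hδ, hδ0⟩ := (hev.and self_mem_nhdsWithin).exists
  have hδ0 : 0 < δ := hδ0
  have := le_csSup hbdd (show s + δ ∈ {s : ℝ | 0 ≤ s ∧ geM c ρ s v < l0 / α} from
    ⟨by positivity, (geM_add_le hc hρ hs0 hv hδ0.le).trans_lt hδ⟩)
  rw [geBoundary] at hs
  linarith

/-- For a supermartingale, a stopped-at-disjoint-events version of optional stopping. -/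
lemma sum_setIntegral_disjointed_le {Ω : Type*} {mΩ : MeasurableSpace Ω} {P : Measure Ω}
    [IsProbabilityMeasure P] {F : Filtration ℕ mΩ} {X : ℕ → Ω → ℝ} (hX : Supermartingale X F P)
    (hX0 : ∀ t ω, 0 ≤ X t ω) {C : ℕ → Set Ω} (hC : ∀ t, MeasurableSet[F t] (C t)) (n : ℕ) :
    ∑ t ∈ Finset.range n, ∫ ω in disjointed C t, X t ω ∂P ≤ ∫ ω, X 0 ω ∂P := by
  have hmeas : ∀ n, ∀ t < n, MeasurableSet[F (n - 1)] (C t) := fun n t ht =>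
    F.mono (by omega) _ (hC t)
  have hD : ∀ n, MeasurableSet[F (n - 1)] (⋂ t < n, (C t)ᶜ) := fun n =>
    MeasurableSet.iInter fun t => MeasurableSet.iInter fun ht => (hmeas n t ht).compl
  have hle : ∀ n, ∑ t ∈ Finset.range n, ∫ ω in disjointed C t, X t ω ∂P +
      ∫ ω in ⋂ t < n, (C t)ᶜ, X n ω ∂P ≤ ∫ ω, X 0 ω ∂P := by
    intro n
    induction n with
    | zero => simp
    | succ n ih =>
      have hsplit : (⋂ t < n, (C t)ᶜ) = disjointed C n ∪ ⋂ t < n + 1, (C t)ᶜ := by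
        rw [disjointed_eq_inter_compl]
        ext ω
        simp only [mem_iInter, mem_union, mem_inter_iff, mem_compl_iff, Nat.lt_succ_iff_lt_or_eq]
        grind
      have hdisj : Disjoint (disjointed C n) (⋂ t < n + 1, (C t)ᶜ) := by
        refine disjoint_left.2 fun ω h1 h2 => ?_
        simp only [mem_iInter, mem_compl_iff] at h2
        exact h2 n (Nat.lt_succ_self n) (disjointed_subset C n h1)
      have hstep := hX.setIntegral_le (Nat.le_succ n) (hD (n + 1))
      rw [hsplit, setIntegral_union hdisj (F.le _ _ (hD (n + 1)))
        (hX.integrable n).integrableOn (hX.integrable n).integrableOn] at ih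
      rw [Finset.sum_range_succ]
      simp only [Nat.succ_eq_add_one] at hstep
      linarith
  refine le_trans ?_ (hle n)
  exact le_add_of_nonneg_right (integral_nonneg fun ω => hX0 n ω)

/-- Ville's inequality for a mixture of exponential processes, each dominated by a
nonnegative supermartingale. -/
lemma mul_measure_exists_le_lintegral_exp_le {Ω : Type*} {mΩ : MeasurableSpace Ω} {P : Measure Ω}
    [IsProbabilityMeasure P] {F : Filtration ℕ mΩ} {S V : ℕ → Ω → ℝ} (hS : Adapted F S)
    (hV : Adapted F V) {ν : Measure ℝ} [IsProbabilityMeasure ν] {ψ : ℝ → ℝ} (hψ : Measurable ψ)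
    {l0 : ℝ} {L : ℝ → ℕ → Ω → ℝ}
    (hL : ∀ t : ℕ, Measurable (Function.uncurry fun l ω => L l t ω))
    (h : ∀ᵐ l ∂ν, Supermartingale (L l) F P ∧ (∀ t ω, 0 ≤ L l t ω) ∧ (∫ ω, L l 0 ω ∂P) ≤ l0 ∧
      ∀ t : ℕ, ∀ᵐ ω ∂P, Real.exp (l * S t ω - ψ l * V t ω) ≤ L l t ω) (K : ℝ≥0∞) :
    K * P {ω | ∃ t, K ≤ ∫⁻ l, ENNReal.ofReal (Real.exp (l * S t ω - ψ l * V t ω)) ∂ν} ≤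
      ENNReal.ofReal l0 := by
  set C : ℕ → Set Ω := fun t =>
    {ω | K ≤ ∫⁻ l, ENNReal.ofReal (Real.exp (l * S t ω - ψ l * V t ω)) ∂ν} with hCdef
  have hmix : Measurable fun p : ℝ × ℝ =>
      ∫⁻ l, ENNReal.ofReal (Real.exp (l * p.1 - ψ l * p.2)) ∂ν := by
    refine Measurable.lintegral_prod_right
      (f := fun (p : ℝ × ℝ) l => ENNReal.ofReal (Real.exp (l * p.1 - ψ l * p.2))) ?_
    unfold Function.uncurry
    fun_prop
  have hC : ∀ t, MeasurableSet[F t] (C t) := fun t =>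
    (hmix.comp ((hS t).prodMk (hV t))) measurableSet_Ici
  have hA : ∀ t, MeasurableSet (disjointed C t) :=
    MeasurableSet.disjointed fun t => F.le t _ (hC t)
  have hLm : ∀ t, Measurable (Function.uncurry fun ω l => ENNReal.ofReal (L l t ω)) := fun t =>
    ((hL t).comp measurable_swap).ennreal_ofReal
  have hdom : ∀ t, ∀ᵐ ω ∂P, ∀ᵐ l ∂ν, Real.exp (l * S t ω - ψ l * V t ω) ≤ L l t ω := by
    intro t
    have hSt := (hS t).mono (F.le t) le_rfl
    have hVt := (hV t).mono (F.le t) le_rfl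
    refine (Measure.ae_ae_comm
      (p := fun l ω => Real.exp (l * S t ω - ψ l * V t ω) ≤ L l t ω) ?_).1
      (h.mono fun l hl => hl.2.2.2 t)
    exact measurableSet_le (by fun_prop) (hL t)
  have hpart : ∀ t, K * P (disjointed C t) ≤
      ∫⁻ l, ∫⁻ ω in disjointed C t, ENNReal.ofReal (L l t ω) ∂P ∂ν := by
    intro t
    rw [← lintegral_lintegral_swap (hLm t).aemeasurable, ← setLIntegral_const]
    refine lintegral_mono_ae ((ae_restrict_iff' (hA t)).2 ((hdom t).mono fun ω hω hmem => ?_))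
    refine le_trans (disjointed_subset C t hmem) (lintegral_mono_ae (hω.mono fun l hl => ?_))
    exact ENNReal.ofReal_le_ofReal hl
  have hU : {ω | ∃ t, K ≤ ∫⁻ l, ENNReal.ofReal (Real.exp (l * S t ω - ψ l * V t ω)) ∂ν} =
      ⋃ t, disjointed C t := by
    rw [iUnion_disjointed]
    ext ω
    simp [hCdef]
  rw [hU]
  calc K * P (⋃ t, disjointed C t) ≤ K * ∑' t, P (disjointed C t) := by
        gcongr
        exact measure_iUnion_le _
    _ = ∑' t, K * P (disjointed C t) := ENNReal.tsum_mul_left.symm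
    _ ≤ ENNReal.ofReal l0 := by
        refine ENNReal.tsum_le_of_sum_range_le fun n => ?_
        refine (Finset.sum_le_sum fun t _ => hpart t).trans ?_
        rw [← lintegral_finsetSum]
        · refine (lintegral_mono_ae (g := fun _ => ENNReal.ofReal l0)
            (h.mono fun l hl => ?_)).trans (by simp)
          obtain ⟨h1, h2, h3, -⟩ := hl
          refine le_trans ?_ (ENNReal.ofReal_le_ofReal
            ((sum_setIntegral_disjointed_le h1 h2 hC n).trans h3))
          rw [ENNReal.ofReal_sum_of_nonneg fun t _ => integral_nonneg fun ω => h2 t ω]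
          refine Finset.sum_le_sum fun t _ => ?_
          rw [ofReal_integral_eq_lintegral_ofReal (h1.integrable t).integrableOn
            (ae_of_all _ fun ω => h2 t ω)]
        · intro t _
          exact Measurable.lintegral_prod_right ((hL t).ennreal_ofReal)

lemma measurable_psiE (c : ℝ) : Measurable (psiE c) := by
  unfold psiE
  fun_prop

lemma measurable_geMixDensity (c ρ : ℝ) : Measurable (geMixDensity c ρ) := by
  unfold geMixDensity
  fun_prop

/-- The mixing distribution with density `geMixDensity c ρ` on `(0, 1/c)`. -/
def geMixMeasure (c ρ : ℝ) : Measure ℝ :=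
  (volume.restrict (Ioo 0 (1 / c))).withDensity fun l => ENNReal.ofReal (geMixDensity c ρ l)

lemma lintegral_geMixMeasure {c ρ s v : ℝ} (hc : 0 < c) (hρ : 0 < ρ) (hs : 0 ≤ s)
    (hv : 0 ≤ v) :
    ∫⁻ l, ENNReal.ofReal (Real.exp (l * s - psiE c l * v)) ∂geMixMeasure c ρ =
      ENNReal.ofReal (geM c ρ s v) := by
  have hψ := measurable_psiE c
  rw [geMixMeasure, lintegral_withDensity_eq_lintegral_mul _
    (measurable_geMixDensity c ρ).ennreal_ofReal (by fun_prop), geM_eq_integral hc hρ hs hv,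
    ofReal_integral_eq_lintegral_ofReal (integrableOn_exp_mul_geMixDensity hc hρ hs hv)]
  · refine lintegral_congr fun l => ?_
    rw [Pi.mul_apply, mul_comm, ← ENNReal.ofReal_mul (Real.exp_pos _).le]
  · refine (ae_restrict_iff' measurableSet_Ioo).2 (ae_of_all _ fun l hl => ?_)
    exact mul_nonneg (Real.exp_pos _).le (geMixDensity_pos hc hρ hl.2).le

lemma isProbabilityMeasure_geMixMeasure {c ρ : ℝ} (hc : 0 < c) (hρ : 0 < ρ) :
    IsProbabilityMeasure (geMixMeasure c ρ) := by
  have h := lintegral_geMixMeasure hc hρ le_rfl (le_refl (0 : ℝ))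
  rw [geM_zero_zero hc hρ] at h
  exact ⟨by simpa using h⟩

/-- Proposition (gamma-exponential mixture): `m(s,v)` equals the mixture integral of
`exp(λs − ψ_{E,c}(λ)v)` against the truncated gamma density, and consequently `GE_α`
is an `l0`-sub-ψ_{E,c} uniform boundary with crossing probability `α`. -/
theorem gamma_exponential_mixture
    (c ρ l0 α : ℝ) (hc : 0 < c) (hρ : 0 < ρ)
    (hα : α ∈ Set.Ioo (0 : ℝ) 1) (hl0 : 1 ≤ l0) :
    (∀ s v : ℝ, 0 ≤ s → 0 ≤ v →
      geM c ρ s v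
        = ∫ l in Set.Ioo (0 : ℝ) (1 / c),
            Real.exp (l * s - psiE c l * v) * geMixDensity c ρ l) ∧
    (∀ (Ω : Type) (mΩ : MeasurableSpace Ω) (P : Measure Ω),
      IsProbabilityMeasure P →
      ∀ (F : Filtration ℕ mΩ) (S V : ℕ → Ω → ℝ),
        IsSubPsiMeas P F {l : ℝ | 0 ≤ l ∧ l < 1 / c} (psiE c) l0 S V →
        P {ω | ∃ t : ℕ, 1 ≤ t ∧ geBoundary c ρ l0 α (V t ω) ≤ S t ω}
          ≤ ENNReal.ofReal α) := by
  refine ⟨fun s v hs hv => geM_eq_integral hc hρ hs hv, ?_⟩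
  rintro Ω mΩ P hP F S V ⟨hS, hV, -, -, hV0, L, hL, hLS⟩
  have hK : 1 < l0 / α := by
    rw [lt_div_iff₀ hα.1]
    linarith [hα.2]
  have := isProbabilityMeasure_geMixMeasure hc hρ
  have hae : ∀ᵐ l ∂geMixMeasure c ρ, l ∈ Ioo (0 : ℝ) (1 / c) :=
    (withDensity_absolutelyContinuous _ _).ae_le (ae_restrict_mem measurableSet_Ioo)
  have hville := mul_measure_exists_le_lintegral_exp_le hS hV (measurable_psiE c) hL
    (hae.mono fun l hl => hLS l ⟨hl.1.le, hl.2⟩) (ENNReal.ofReal (l0 / α))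
  have hsub : {ω | ∃ t : ℕ, 1 ≤ t ∧ geBoundary c ρ l0 α (V t ω) ≤ S t ω} ⊆
      {ω | ∃ t, ENNReal.ofReal (l0 / α) ≤
        ∫⁻ l, ENNReal.ofReal (Real.exp (l * S t ω - psiE c l * V t ω)) ∂geMixMeasure c ρ} := by
    rintro ω ⟨t, -, ht⟩
    obtain ⟨h1, h2⟩ := le_geM_of_geBoundary_le hc hρ hK (hV0 t ω) ht
    refine ⟨t, ?_⟩
    rw [lintegral_geMixMeasure hc hρ h1 (hV0 t ω)]
    exact ENNReal.ofReal_le_ofReal h2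
  refine (measure_mono hsub).trans ?_
  have hK0 : 0 < l0 / α := one_pos.trans hK
  rw [show ENNReal.ofReal l0 = ENNReal.ofReal (l0 / α) * ENNReal.ofReal α by
    rw [← ENNReal.ofReal_mul hK0.le, div_mul_cancel₀ _ hα.1.ne']] at hville
  exact (ENNReal.mul_le_mul_iff_right (ENNReal.ofReal_pos.2 hK0).ne' ENNReal.ofReal_ne_top).1 hville
end
end

section
/- Empirical-Bernstein supermartingale: Let (X_t)_{t≥1} be adapted with X_t ∈ [0,1] a.s. for all t, and let (X̂_t)_{t≥1} be a predictable sequence with X̂_t ∈ [0,1] a.s. Set Y_t := X_t − E[X_t | F_{t−1}] and V_t := Σ_{i=1}^t (X_i − X̂_i)². Then for every λ ∈ [0,1), the process t ↦ exp( λ Σ_{i=1}^t Y_i − ψ_{E,1}(λ) V_t ) (with value 1 at t = 0) is a supermartingale with respect to (F_t). -/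
open MeasureTheory ProbabilityTheory Filter Set

noncomputable section

/-- **Fan's inequality**: `exp (l x - ψ(l) x²) ≤ 1 + l x` for `0 ≤ l < 1` and `|x| ≤ 1`, where
`ψ(l) = -log (1 - l) - l`. -/
theorem exp_mul_sub_mul_sq_le {l x : ℝ} (hl0 : 0 ≤ l) (hl1 : l < 1) (hx : |x| ≤ 1) :
    Real.exp (l * x - (-Real.log (1 - l) - l) * x ^ 2) ≤ 1 + l * x := by
  have habs : |-(l * x)| < 1 := by
    rw [abs_neg, abs_mul, abs_of_nonneg hl0]
    nlinarith [abs_nonneg x]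
  have hpos : 0 < 1 + l * x := by linarith [(abs_lt.1 habs).2]
  have tail {y : ℝ} (hy : |y| < 1) :
      HasSum (fun n : ℕ => y ^ (n + 2) / ((n : ℝ) + 2)) (-Real.log (1 - y) - y) := by
    have h := (hasSum_nat_add_iff' 1).2 (Real.hasSum_pow_div_log_of_abs_lt_one hy)
    simpa [add_assoc, one_add_one_eq_two] using h
  have hcmp := hasSum_le (fun n : ℕ => ?_) (tail habs)
    ((tail (abs_lt.2 ⟨by linarith, hl1⟩)).mul_left (x ^ 2))
  · rw [← Real.le_log_iff_exp_le hpos]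
    rw [sub_neg_eq_add, sub_neg_eq_add] at hcmp
    linarith
  · rw [← mul_div_assoc]
    gcongr
    calc (-(l * x)) ^ (n + 2) ≤ |(-(l * x)) ^ (n + 2)| := le_abs_self _
      _ = |x| ^ n * (x ^ 2 * l ^ (n + 2)) := by
        rw [abs_pow, abs_neg, abs_mul, abs_of_nonneg hl0, ← sq_abs x]
        ring
      _ ≤ 1 * (x ^ 2 * l ^ (n + 2)) := by
        gcongr
        exact pow_le_one₀ (abs_nonneg x) hx
      _ = x ^ 2 * l ^ (n + 2) := one_mul _

theorem neg_log_one_sub_sub_nonneg {l : ℝ} (hl1 : l < 1) : 0 ≤ -Real.log (1 - l) - l := by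
  linarith [Real.log_le_sub_one_of_pos (sub_pos.2 hl1)]

section Conditional

variable {Ω : Type*} {m mΩ : MeasurableSpace Ω} {P : Measure Ω} [IsProbabilityMeasure P]
  {X H : Ω → ℝ} {l : ℝ}

theorem condExp_mem_Icc_zero_one (hm : m ≤ mΩ) (hX : Integrable X P)
    (hXbd : ∀ᵐ ω ∂P, X ω ∈ Set.Icc (0 : ℝ) 1) :
    ∀ᵐ ω ∂P, (P[X|m]) ω ∈ Set.Icc (0 : ℝ) 1 := by
  have hlow : 0 ≤ᵐ[P] P[X|m] := condExp_nonneg (hXbd.mono fun _ h => h.1)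
  have hup : P[X|m] ≤ᵐ[P] P[fun _ => (1 : ℝ)|m] :=
    condExp_mono hX (integrable_const 1) (hXbd.mono fun _ h => h.2)
  rw [condExp_const hm] at hup
  filter_upwards [hlow, hup] with ω h0 h1 using ⟨h0, h1⟩

theorem exp_increment_le (hl0 : 0 ≤ l) (hl1 : l < 1) {x a : ℝ} (b : ℝ)
    (hx : x ∈ Set.Icc (0 : ℝ) 1) (ha : a ∈ Set.Icc (0 : ℝ) 1) :
    Real.exp (l * (x - a) - (-Real.log (1 - l) - l) * (x - b) ^ 2) ≤ Real.exp l := by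
  refine Real.exp_le_exp.2 ?_
  have := mul_nonneg (neg_log_one_sub_sub_nonneg hl1) (sq_nonneg (x - b))
  nlinarith [hx.2, ha.1]

theorem integrable_exp_increment (hm : m ≤ mΩ) (hl0 : 0 ≤ l) (hl1 : l < 1)
    (hX : Integrable X P) (hXbd : ∀ᵐ ω ∂P, X ω ∈ Set.Icc (0 : ℝ) 1)
    (hH : StronglyMeasurable[m] H) :
    Integrable (fun ω => Real.exp
      (l * (X ω - (P[X|m]) ω) - (-Real.log (1 - l) - l) * (X ω - H ω) ^ 2)) P := by
  refine Integrable.of_bound (Real.continuous_exp.comp_aestronglyMeasurable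
    (((hX.1.sub integrable_condExp.1).const_mul l).sub
      (((hX.1.sub (hH.mono hm).aestronglyMeasurable).pow 2).const_mul _))) (Real.exp l) ?_
  filter_upwards [hXbd, condExp_mem_Icc_zero_one hm hX hXbd] with ω hx ha
  rw [Real.norm_eq_abs, Real.abs_exp]
  exact exp_increment_le hl0 hl1 _ hx ha

theorem condExp_exp_increment_le_one (hm : m ≤ mΩ) (hl0 : 0 ≤ l) (hl1 : l < 1)
    (hX : Integrable X P) (hXbd : ∀ᵐ ω ∂P, X ω ∈ Set.Icc (0 : ℝ) 1)
    (hH : StronglyMeasurable[m] H) (hHbd : ∀ᵐ ω ∂P, H ω ∈ Set.Icc (0 : ℝ) 1) :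
    P[fun ω => Real.exp
      (l * (X ω - (P[X|m]) ω) - (-Real.log (1 - l) - l) * (X ω - H ω) ^ 2)|m] ≤ᵐ[P] 1 := by
  have hbd := condExp_mem_Icc_zero_one hm hX hXbd
  have hHint : Integrable H P := by
    refine Integrable.of_bound (hH.mono hm).aestronglyMeasurable 1 ?_
    filter_upwards [hHbd] with ω h
    rw [Real.norm_eq_abs, abs_le]
    constructor <;> linarith [h.1, h.2]
  set C : Ω → ℝ := fun ω => Real.exp (-(l * ((P[X|m]) ω - H ω)))
  have hC : StronglyMeasurable[m] C := Real.continuous_exp.comp_stronglyMeasurable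
    ((stronglyMeasurable_condExp.sub hH).const_mul l).neg
  have hCbd : ∀ᵐ ω ∂P, ‖C ω‖ ≤ Real.exp l := by
    filter_upwards [hbd, hHbd] with ω ha hb
    rw [Real.norm_eq_abs, Real.abs_exp]
    refine Real.exp_le_exp.2 ?_
    nlinarith [ha.1, hb.2]
  set A : Ω → ℝ := fun ω => 1 - l * H ω
  have hA : StronglyMeasurable[m] A := stronglyMeasurable_const.sub (hH.const_mul l)
  have hAint : Integrable A P := (integrable_const 1).sub (hHint.const_mul l)
  have hGint : Integrable (A + l • X) P := hAint.add (hX.smul l)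
  have hle : (fun ω => Real.exp
      (l * (X ω - (P[X|m]) ω) - (-Real.log (1 - l) - l) * (X ω - H ω) ^ 2))
      ≤ᵐ[P] C * (A + l • X) := by
    filter_upwards [hXbd, hHbd] with ω hx hb
    have hfan := exp_mul_sub_mul_sq_le hl0 hl1 (x := X ω - H ω)
      (abs_le.2 ⟨by linarith [hx.1, hb.2], by linarith [hx.2, hb.1]⟩)
    calc Real.exp (l * (X ω - (P[X|m]) ω) - (-Real.log (1 - l) - l) * (X ω - H ω) ^ 2)
        = C ω * Real.exp (l * (X ω - H ω) - (-Real.log (1 - l) - l) * (X ω - H ω) ^ 2) := by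
          rw [← Real.exp_add]
          ring_nf
      _ ≤ C ω * (1 + l * (X ω - H ω)) := by gcongr
      _ = (C * (A + l • X)) ω := by
          simp only [A, Pi.mul_apply, Pi.add_apply, Pi.smul_apply, smul_eq_mul]
          ring
  have hmono := condExp_mono (m := m) (integrable_exp_increment hm hl0 hl1 hX hXbd hH)
    (hGint.bdd_mul (hC.mono hm).aestronglyMeasurable hCbd) hle
  filter_upwards [hmono, condExp_stronglyMeasurable_mul_of_bound hm hC hGint _ hCbd,
    condExp_add hAint (hX.smul l) m, condExp_smul l X m (μ := P)] with ω h1 h2 h3 h4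
  refine h1.trans (h2.trans_le ?_)
  rw [ Pi.mul_apply, h3, Pi.add_apply, h4, condExp_of_stronglyMeasurable hm hA hAint]
  simp only [A, C, Pi.smul_apply, smul_eq_mul, Pi.one_apply]
  rw [Real.exp_neg, inv_mul_le_one₀ (Real.exp_pos _)]
  linarith [Real.add_one_le_exp (l * ((P[X|m]) ω - H ω))]

end Conditional

/-- Key step of Theorem 4 (empirical-Bernstein supermartingale): for `[0,1]`-valued
adapted `(X_t)` and `[0,1]`-valued predictable predictions `(X̂_t)`, setting
`Y_t = X_t − E[X_t | F_{t−1}]` and `V_t = Σ_{i≤t} (X_i − X̂_i)²`, the process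
`exp(λ Σ_{i≤t} Y_i − ψ_{E,1}(λ) V_t)` is a supermartingale for every `λ ∈ [0,1)`. -/
theorem empirical_bernstein_supermartingale
    {Ω : Type*} {mΩ : MeasurableSpace Ω} (P : Measure Ω) [IsProbabilityMeasure P]
    (F : Filtration ℕ mΩ) (X Xhat : ℕ → Ω → ℝ)
    (hXadp : Adapted F X) (hXint : ∀ t, Integrable (X t) P)
    (hXbd : ∀ t : ℕ, ∀ᵐ ω ∂P, X t ω ∈ Set.Icc (0 : ℝ) 1)
    (hXhatbd : ∀ t : ℕ, ∀ᵐ ω ∂P, Xhat t ω ∈ Set.Icc (0 : ℝ) 1)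
    (hXhatpred : ∀ t : ℕ, StronglyMeasurable[F t] (Xhat (t + 1)))
    (l : ℝ) (hl : l ∈ Set.Ico (0 : ℝ) 1) :
    Supermartingale
      (fun t ω =>
        Real.exp (l * (∑ i ∈ Finset.Icc 1 t, (X i ω - (P[X i|F (i - 1)]) ω))
          - (-Real.log (1 - l) - l)
            * ∑ i ∈ Finset.Icc 1 t, (X i ω - Xhat i ω) ^ 2))
      F P := by
  obtain ⟨hl0, hl1⟩ := hl
  set M : ℕ → Ω → ℝ := fun t ω =>
    Real.exp (l * (∑ i ∈ Finset.Icc 1 t, (X i ω - (P[X i|F (i - 1)]) ω))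
      - (-Real.log (1 - l) - l) * ∑ i ∈ Finset.Icc 1 t, (X i ω - Xhat i ω) ^ 2)
  set Z : ℕ → Ω → ℝ := fun t ω =>
    Real.exp (l * (X (t + 1) ω - (P[X (t + 1)|F t]) ω)
      - (-Real.log (1 - l) - l) * (X (t + 1) ω - Xhat (t + 1) ω) ^ 2)
  have hsucc (t : ℕ) : M (t + 1) = M t * Z t := by
    ext ω
    simp only [M, Z, Pi.mul_apply, ← Real.exp_add,
      Finset.sum_Icc_succ_top (Nat.le_add_left 1 t), Nat.add_sub_cancel]
    ring_nf
  have hzero : M 0 = fun _ => 1 := by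
    ext ω
    simp [M]
  have hZmeas (t : ℕ) : StronglyMeasurable[F (t + 1)] (Z t) := by
    have hmono := F.mono (Nat.le_succ t)
    exact Real.continuous_exp.comp_stronglyMeasurable
      ((((hXadp.stronglyAdapted (t + 1)).sub (stronglyMeasurable_condExp.mono hmono)).const_mul
        l).sub ((((hXadp.stronglyAdapted (t + 1)).sub
          ((hXhatpred t).mono hmono)).pow 2).const_mul _))
  have hMmeas : StronglyAdapted F M := by
    intro t
    induction t with
    | zero => rw [hzero]; exact stronglyMeasurable_const
    | succ t ih => rw [hsucc]; exact (ih.mono (F.mono (Nat.le_succ t))).mul (hZmeas t)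
  have hMbd (t : ℕ) : ∀ᵐ ω ∂P, ‖M t ω‖ ≤ Real.exp l ^ t := by
    induction t with
    | zero => simp [hzero]
    | succ t ih =>
      filter_upwards [ih, hXbd (t + 1),
        condExp_mem_Icc_zero_one (F.le t) (hXint (t + 1)) (hXbd (t + 1))] with ω h hx ha
      rw [hsucc, Pi.mul_apply, norm_mul, pow_succ, Real.norm_eq_abs (Z t ω), Real.abs_exp]
      exact mul_le_mul h (exp_increment_le hl0 hl1 _ hx ha) (Real.exp_pos _).le (by positivity)
  refine supermartingale_nat hMmeas (fun t => .of_bound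
    ((hMmeas t).mono (F.le t)).aestronglyMeasurable _ (hMbd t)) fun t => ?_
  have hZint : Integrable (Z t) P :=
    integrable_exp_increment (F.le t) hl0 hl1 (hXint _) (hXbd _) (hXhatpred t)
  rw [hsucc]
  filter_upwards [condExp_stronglyMeasurable_mul_of_bound (F.le t) (hMmeas t) hZint _ (hMbd t),
    condExp_exp_increment_le_one (F.le t) hl0 hl1 (hXint _) (hXbd _) (hXhatpred t)
      (hXhatbd _)] with ω h1 h2
  rw [h1, Pi.mul_apply]
  exact mul_le_of_le_one_right (Real.exp_pos _).le h2
end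
end
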